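/- arXiv:2003.04281 — 2 statements merged into one kernel-verified Lean document; each statement's English description precedes it below -/
import Mathlib

section
/- Let K be a 3×3 diagonalizable matrix with simple spectrum and nonzero eigenvalues such that T₁^{(K)}(λ) is diagonalizable with simple spectrum (as holds for generic inhomogeneities), with eigenvector and eigencovector bases |t_a^{(K)}⟩, ⟨t_a^{(K)}|, a ∈ {1,…,3^N}, satisfying ⟨t_a^{(K)}|t_a^{(K)}⟩ ≠ 0. Let K̂ be obtained from K by setting one of its eigenvalues to zero, keeping simple spectrum and diagonalizability, and let t_{j,a}^{(K̂)}(λ) (j = 1,2) be an enumeration of the joint eigenvalue functions of T₁^{(K̂)}, T₂^{(K̂)}. Define the operators 𝕋_j^{(K)}(λ) = Σ_{a=1}^{3^N} t_{j,a}^{(K̂)}(λ) |t_a^{(K)}⟩⟨t_a^{(K)}| / ⟨t_a^{(K)}|t_a^{(K)}⟩, j = 1,2. Then: (a) [𝕋_l^{(K)}(λ), 𝕋_m^{(K)}(μ)] = [T_l^{(K)}(λ), 𝕋_m^{(K)}(μ)] = 0 for all l,m ∈ {1,2} and all λ, μ; (b) the simplified fusion relations hold: 𝕋₂^{(K)}(ξ_a^{(1)})𝕋₁^{(K)}(ξ_a)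 = 𝕋₂^{(K)}(ξ_a^{(1)})𝕋₂^{(K)}(ξ_a) = 0 and 𝕋₁^{(K)}(ξ_a^{(1)})𝕋₁^{(K)}(ξ_a) = 𝕋₂^{(K)}(ξ_a) for all a; (c) the SoV bases built from 𝕋, namely ⟨ĥ| = ⟨1|∏_n 𝕋₂^{(K)}(ξ_n^{(1)})^{δ_{h_n,0}} 𝕋₁^{(K)}(ξ_n)^{δ_{h_n,2}} and |ĥ⟩ = ∏_n 𝕋₂^{(K)}(ξ_n)^{δ_{h_n,1}} 𝕋₁^{(K)}(ξ_n)^{δ_{h_n,2}}|0⟩, are mutually orthogonal: ⟨k̂|ĥ⟩ = δ_{h,k} N_h with N_h = (∏_a d(ξ_a^{(1)})/d(ξ_a^{(1+δ_{h_a,1}+δ_{h_a,2})}))·V(ξ₁,…,ξ_N)²/(V(ξ₁^{(δ_{h₁,1}+δ_{h₁,2})},…)·V(ξ₁^{(δ_{h₁,2})},…)). -/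
open scoped BigOperators

namespace SoV

noncomputable section

/-- Quantum states of the gl₃ chain of length `N`: labels of the natural tensor basis
of `H = (ℂ³)^{⊗N}`. -/
abbrev St (N : ℕ) := Fin N → Fin 3
/-- The Hilbert space `H` (and its dual), realized as functions on basis labels. -/
abbrev Hsp (N : ℕ) := St N → ℂ
/-- Operators on `H`. -/
abbrev Op (N : ℕ) := Matrix (St N) (St N) ℂ

variable {N : ℕ}

/-- ξᵢ − ξⱼ ∉ {0, η, −η} for i ≠ j. -/
def InhomCond (η : ℂ) (ξ : Fin N → ℂ) : Prop :=
  ∀ i j : Fin N, i ≠ j → ξ i - ξ j ≠ 0 ∧ ξ i - ξ j ≠ η ∧ ξ i - ξ j ≠ -η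

/-- Vandermonde product `V(x₁,…,x_M) = ∏_{i<j} (x_j − x_i)`. -/
def Vdm {M : ℕ} (x : Fin M → ℂ) : ℂ :=
  ∏ j : Fin M, ∏ i ∈ Finset.univ.filter (fun i => i < j), (x j - x i)

/-- `d(λ) = ∏_a (λ − ξ_a)`. -/
def dfun (ξ : Fin N → ℂ) (lam : ℂ) : ℂ := ∏ a, (lam - ξ a)

/-- The quantum determinant at identity twist:
`q-det M^{(I)}(λ) = ∏_b (λ−ξ_b+η)(λ−ξ_b−η)(λ−ξ_b−2η)`. -/
def qdetI (η : ℂ) (ξ : Fin N → ℂ) (lam : ℂ) : ℂ :=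
  ∏ b, ((lam - ξ b + η) * (lam - ξ b - η) * (lam - ξ b - 2 * η))

/-- The rational gl₃ R-matrix `R_{a,n}(λ − ξ_n) = (λ−ξ_n)·Id + η·P` acting on the
auxiliary space (first factor) and the `n`-th site of the chain. -/
def Raux (η : ℂ) (ξ : Fin N → ℂ) (lam : ℂ) (n : Fin N) :
    Matrix (Fin 3 × St N) (Fin 3 × St N) ℂ := Matrix.of fun p q =>
  (lam - ξ n) * (if p = q then 1 else 0) +
    η * (if p.1 = q.2 n ∧ p.2 = Function.update q.2 n q.1 then 1 else 0)

/-- The twist matrix `K` acting on the auxiliary space. -/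
def Kaux (K : Matrix (Fin 3) (Fin 3) ℂ) :
    Matrix (Fin 3 × St N) (Fin 3 × St N) ℂ := Matrix.of fun p q =>
  K p.1 q.1 * (if p.2 = q.2 then 1 else 0)

/-- The monodromy matrix `M^{(K)}(λ) = K_a R_{a,N}(λ−ξ_N) ⋯ R_{a,1}(λ−ξ_1)`. -/
def monodromy (η : ℂ) (ξ : Fin N → ℂ) (K : Matrix (Fin 3) (Fin 3) ℂ) (lam : ℂ) :
    Matrix (Fin 3 × St N) (Fin 3 × St N) ℂ :=
  Kaux K * ((List.ofFn fun n : Fin N => Raux η ξ lam n).reverse.prod)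

/-- The transfer matrix `T₁^{(K)}(λ) = tr_a M^{(K)}(λ)`. -/
def T1 (η : ℂ) (ξ : Fin N → ℂ) (K : Matrix (Fin 3) (Fin 3) ℂ) (lam : ℂ) : Op N :=
  Matrix.of fun f g => ∑ v : Fin 3, monodromy η ξ K lam (v, f) (v, g)

/-- Embedding of an (aux ⊗ H)-operator using the first of two auxiliary spaces. -/
def emb1 (M : Matrix (Fin 3 × St N) (Fin 3 × St N) ℂ) :
    Matrix ((Fin 3 × Fin 3) × St N) ((Fin 3 × Fin 3) × St N) ℂ := Matrix.of fun p q =>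
  M (p.1.1, p.2) (q.1.1, q.2) * (if p.1.2 = q.1.2 then 1 else 0)

/-- Embedding of an (aux ⊗ H)-operator using the second of two auxiliary spaces. -/
def emb2 (M : Matrix (Fin 3 × St N) (Fin 3 × St N) ℂ) :
    Matrix ((Fin 3 × Fin 3) × St N) ((Fin 3 × Fin 3) × St N) ℂ := Matrix.of fun p q =>
  M (p.1.2, p.2) (q.1.2, q.2) * (if p.1.1 = q.1.1 then 1 else 0)

/-- The antisymmetrizer `P⁻₁₂` on the two auxiliary spaces (acting trivially on `H`). -/
def antisym2 : Matrix ((Fin 3 × Fin 3) × St N) ((Fin 3 × Fin 3) × St N) ℂ :=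
  Matrix.of fun p q =>
    (if p.2 = q.2 then 1 else 0) *
      ((2 : ℂ)⁻¹ * ((if p.1 = q.1 then 1 else 0) - (if p.1 = (q.1.2, q.1.1) then 1 else 0)))

/-- The fused transfer matrix
`T₂^{(K)}(λ) = tr_{12} [P⁻₁₂ M₁^{(K)}(λ) M₂^{(K)}(λ−η)]`. -/
def T2 (η : ℂ) (ξ : Fin N → ℂ) (K : Matrix (Fin 3) (Fin 3) ℂ) (lam : ℂ) : Op N :=
  Matrix.of fun f g => ∑ v : Fin 3 × Fin 3,
    ((antisym2 * emb1 (monodromy η ξ K lam) * emb2 (monodromy η ξ K (lam - η)) :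
      Matrix ((Fin 3 × Fin 3) × St N) ((Fin 3 × Fin 3) × St N) ℂ)) (v, f) (v, g)

/-- A matrix has simple spectrum iff its minimal and characteristic polynomials coincide. -/
def SimpleSpectrum (K : Matrix (Fin 3) (Fin 3) ℂ) : Prop := minpoly ℂ K = K.charpoly

/-- The conserved-charge product `∏_n T₂^{(K)}(ξ_n−η)^{δ_{h_n,0}} T₁^{(K)}(ξ_n)^{δ_{h_n,2}}`
generating the SoV co-vector basis. -/
def sovCovOp (η : ℂ) (ξ : Fin N → ℂ) (K : Matrix (Fin 3) (Fin 3) ℂ) (h : St N) : Op N :=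
  (List.ofFn fun n : Fin N =>
    T2 η ξ K (ξ n - η) ^ (if h n = 0 then 1 else 0) *
      T1 η ξ K (ξ n) ^ (if h n = 2 then 1 else 0)).prod

/-- The SoV co-vector `⟨h| = ⟨1| ∏_n T₂^{(K)}(ξ_n−η)^{δ_{h_n,0}} T₁^{(K)}(ξ_n)^{δ_{h_n,2}}`. -/
def sovCov (η : ℂ) (ξ : Fin N → ℂ) (K : Matrix (Fin 3) (Fin 3) ℂ) (L : Hsp N) (h : St N) :
    Hsp N := Matrix.vecMul L (sovCovOp η ξ K h)

/-- The conserved-charge product `∏_n T₂^{(K)}(ξ_n)^{δ_{h_n,1}} T₁^{(K)}(ξ_n)^{δ_{h_n,2}}`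
generating the SoV vector basis. -/
def sovVecOp (η : ℂ) (ξ : Fin N → ℂ) (K : Matrix (Fin 3) (Fin 3) ℂ) (h : St N) : Op N :=
  (List.ofFn fun n : Fin N =>
    T2 η ξ K (ξ n) ^ (if h n = 1 then 1 else 0) *
      T1 η ξ K (ξ n) ^ (if h n = 2 then 1 else 0)).prod

/-- The SoV vector `|h⟩ = ∏_n T₂^{(K)}(ξ_n)^{δ_{h_n,1}} T₁^{(K)}(ξ_n)^{δ_{h_n,2}} |0⟩`. -/
def sovVec (η : ℂ) (ξ : Fin N → ℂ) (K : Matrix (Fin 3) (Fin 3) ℂ) (R0 : Hsp N) (h : St N) :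
    Hsp N := Matrix.mulVec (sovVecOp η ξ K h) R0

/-- Pairing ⟨L|v⟩ between a co-vector and a vector. -/
def pair (L v : Hsp N) : ℂ := ∑ f, L f * v f

/-- A family of `3^N` (co-)vectors is a basis of `H`. -/
def IsBasisFamily (v : St N → Hsp N) : Prop :=
  LinearIndependent ℂ v ∧ Submodule.span ℂ (Set.range v) = ⊤

/-- The label `(0,…,0)`. -/
def zeroSt : St N := fun _ => 0

/-- `R0` is the reference vector `|0⟩`, characterized by `⟨k|0⟩ = ∏_a δ_{k_a,0}`. -/
def DualRef (η : ℂ) (ξ : Fin N → ℂ) (K : Matrix (Fin 3) (Fin 3) ℂ) (L R0 : Hsp N) : Prop :=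
  ∀ k : St N, pair (sovCov η ξ K L k) R0 = if k = zeroSt then 1 else 0

/-- The diagonal SoV coupling `N_h`. -/
def Nh (η : ℂ) (ξ : Fin N → ℂ) (h : St N) : ℂ :=
  (∏ a, dfun ξ (ξ a - η) / dfun ξ (ξ a - ((1 : ℂ) + (if h a = 0 then 0 else 1)) * η)) *
    Vdm ξ ^ 2 /
      (Vdm (fun a => ξ a - (if h a = 0 then 0 else 1 : ℂ) * η) *
        Vdm (fun a => ξ a - (if h a = 2 then 1 else 0 : ℂ) * η))

/-- The 3×3 Jordan-type matrix with diagonal `(k₀,k₁,k₂)` and superdiagonal `(y₁,y₂)`. -/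
def KJmat (k₀ k₁ k₂ y₁ y₂ : ℂ) : Matrix (Fin 3) (Fin 3) ℂ := !![k₀, y₁, 0; 0, k₁, y₂; 0, 0, k₂]

/-- `W` conjugates `K` to its Jordan form with data `(k₀,k₁,k₂,y₁,y₂)`. -/
def JordanData (K W : Matrix (Fin 3) (Fin 3) ℂ) (k₀ k₁ k₂ y₁ y₂ : ℂ) : Prop :=
  IsUnit W.det ∧ K = W * KJmat k₀ k₁ k₂ y₁ y₂ * W⁻¹

/-- The tensor product co-vector `⟨L| = (⊗_a (x,y,z)_a)·Γ_W⁻¹`. -/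
def tensorCov (W : Matrix (Fin 3) (Fin 3) ℂ) (x y z : ℂ) : Hsp N :=
  fun f => ∏ a, Matrix.vecMul ![x, y, z] W⁻¹ (f a)

/-- The tensor product vector `|R⟩ = Γ_W·(⊗_a (r,s,t)_aᵗ)`. -/
def tensorVec (W : Matrix (Fin 3) (Fin 3) ℂ) (r s t : ℂ) : Hsp N :=
  fun f => ∏ a, Matrix.mulVec W ![r, s, t] (f a)

/-- `1_k = {a : k_a = 1}`. -/
def ones (k : St N) : Finset (Fin N) := Finset.univ.filter fun a => k a = 1

/-- `n_k = ⌊#1_k / 2⌋`. -/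
def nhalf (k : St N) : ℕ := (ones k).card / 2

/-- `k_{α,β}^{(0,2)}`: the label `k` with entries in `α` set to `0` and entries in `β` set to `2`. -/
def kab (k : St N) (α β : Finset (Fin N)) : St N :=
  fun a => if a ∈ α then 0 else if a ∈ β then 2 else k a

end
end SoV

namespace SoV
noncomputable section
variable {N : ℕ}

/-- The new conserved charges
`𝕋_j^{(K)}(λ) = Σ_a t_{j,a}^{(K̂)}(λ) |t_a^{(K)}⟩⟨t_a^{(K)}| / ⟨t_a^{(K)}|t_a^{(K)}⟩`,
built from the eigenstates of `T₁^{(K)}` and the eigenvalue functions of the `K̂` transfer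
matrices. -/
def TTop (va ca : St N → Hsp N) (thj : St N → ℂ → ℂ) (lam : ℂ) : Op N :=
  ∑ a : St N, (thj a lam * (pair (ca a) (va a))⁻¹) • Matrix.vecMulVec (va a) (ca a)

/-- The SoV co-vectors built from the charges `𝕋_j^{(K)}`. -/
def hatCov (η : ℂ) (ξ : Fin N → ℂ) (va ca : St N → Hsp N) (t1h t2h : St N → ℂ → ℂ)
    (L : Hsp N) (h : St N) : Hsp N :=
  Matrix.vecMul L
    ((List.ofFn fun n : Fin N =>
      TTop va ca t2h (ξ n - η) ^ (if h n = 0 then 1 else 0) *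
        TTop va ca t1h (ξ n) ^ (if h n = 2 then 1 else 0)).prod)

/-- The SoV vectors built from the charges `𝕋_j^{(K)}`. -/
def hatVec (η : ℂ) (ξ : Fin N → ℂ) (va ca : St N → Hsp N) (t1h t2h : St N → ℂ → ℂ)
    (R0 : Hsp N) (h : St N) : Hsp N :=
  Matrix.mulVec
    ((List.ofFn fun n : Fin N =>
      TTop va ca t2h (ξ n) ^ (if h n = 1 then 1 else 0) *
        TTop va ca t1h (ξ n) ^ (if h n = 2 then 1 else 0)).prod) R0

/-! ### Pairs of `3 × 3` matrices with entries in a noncommutative algebra -/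

section Fusion

variable {S : Type*} [Ring S]

/-- `P⁺₁₂ A₁ B₂ P⁻₁₂ = 0`, entrywise. -/
def PreservesAntisymm (A B : Matrix (Fin 3) (Fin 3) S) : Prop :=
  ∀ i j k l, A i k * B j l + A j k * B i l = A i l * B j k + A j l * B i k

/-- `P⁺₁₂ A₁ B₂ = 0`, entrywise. -/
def LeftAntisymm (A B : Matrix (Fin 3) (Fin 3) S) : Prop :=
  ∀ i j k l, A i k * B j l + A j k * B i l = 0

/-- `A₁ B₂ P⁻₁₂ = 0`, entrywise. -/
def RightSymm (A B : Matrix (Fin 3) (Fin 3) S) : Prop :=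
  ∀ i j k l, A i k * B j l = A i l * B j k

/-- All entries of `A` commute with all entries of `B`. -/
def EntriesCommute (A B : Matrix (Fin 3) (Fin 3) S) : Prop :=
  ∀ i j k l, Commute (A i j) (B k l)

lemma EntriesCommute.mul_left {A A' B : Matrix (Fin 3) (Fin 3) S}
    (h : EntriesCommute A B) (h' : EntriesCommute A' B) : EntriesCommute (A * A') B := by
  intro i j k l
  rw [Matrix.mul_apply]
  exact Commute.sum_left _ _ _ fun p _ => (h i p k l).mul_left (h' p j k l)

lemma EntriesCommute.mul_right {A B B' : Matrix (Fin 3) (Fin 3) S}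
    (h : EntriesCommute A B) (h' : EntriesCommute A B') : EntriesCommute A (B * B') := by
  intro i j k l
  rw [Matrix.mul_apply]
  exact Commute.sum_right _ _ _ fun p _ => (h i j k p).mul_right (h' i j p l)

lemma entriesCommute_one_left (B : Matrix (Fin 3) (Fin 3) S) : EntriesCommute 1 B := by
  intro i j k l
  rw [Matrix.one_apply]
  split_ifs
  · exact Commute.one_left _
  · exact Commute.zero_left _

lemma entriesCommute_one_right (A : Matrix (Fin 3) (Fin 3) S) : EntriesCommute A 1 :=
  fun i j k l => (entriesCommute_one_left A k l i j).symm

lemma mul_apply_mul_mul_apply {A A' B B' : Matrix (Fin 3) (Fin 3) S}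
    (h : EntriesCommute A' B) (i j k l : Fin 3) :
    (A * A') i k * (B * B') j l = ∑ p, ∑ q, A i p * B j q * (A' p k * B' q l) := by
  rw [Matrix.mul_apply, Matrix.mul_apply, Finset.sum_mul]
  refine Finset.sum_congr rfl fun p _ => ?_
  rw [Finset.mul_sum]
  refine Finset.sum_congr rfl fun q _ => ?_
  have := (h p k j q).eq
  rw [mul_assoc, ← mul_assoc (A' p k), this]
  simp only [mul_assoc]

lemma LeftAntisymm.mul_right {A A' B B' : Matrix (Fin 3) (Fin 3) S}
    (hAB : LeftAntisymm A B) (h : EntriesCommute A' B) :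
    LeftAntisymm (A * A') (B * B') := by
  intro i j k l
  simp only [mul_apply_mul_mul_apply h, ← Finset.sum_add_distrib, ← add_mul]
  refine Finset.sum_eq_zero fun p _ => Finset.sum_eq_zero fun q _ => ?_
  rw [hAB, zero_mul]

lemma RightSymm.mul_left {A A' B B' : Matrix (Fin 3) (Fin 3) S}
    (hAB' : RightSymm A' B') (h : EntriesCommute A' B) :
    RightSymm (A * A') (B * B') := by
  intro i j k l
  simp only [mul_apply_mul_mul_apply h]
  refine Finset.sum_congr rfl fun p _ => Finset.sum_congr rfl fun q _ => ?_
  rw [hAB' p q k l]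

variable [Algebra ℂ S]

lemma sum_symm_mul_antisymm {U V : Fin 3 → Fin 3 → S} (hU : ∀ p q, U p q = U q p)
    (hV : ∀ p q, V p q + V q p = 0) : ∑ p, ∑ q, U p q * V p q = 0 := by
  have h2 : (2 : ℂ) • ∑ p, ∑ q, U p q * V p q = 0 := by
    rw [two_smul]
    nth_rewrite 2 [Finset.sum_comm]
    simp only [← Finset.sum_add_distrib]
    refine Finset.sum_eq_zero fun p _ => Finset.sum_eq_zero fun q _ => ?_
    rw [hU q p, ← mul_add, hV, mul_zero]
  have := congrArg (fun x => (2 : ℂ)⁻¹ • x) h2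
  simpa [smul_smul] using this

lemma PreservesAntisymm.mul {A A' B B' : Matrix (Fin 3) (Fin 3) S}
    (hAB : PreservesAntisymm A B) (hAB' : PreservesAntisymm A' B')
    (h : EntriesCommute A' B) : PreservesAntisymm (A * A') (B * B') := by
  intro i j k l
  simp only [mul_apply_mul_mul_apply h]
  have := sum_symm_mul_antisymm (U := fun p q => A i p * B j q + A j p * B i q)
    (V := fun p q => A' p k * B' q l - A' p l * B' q k)
    (fun p q => hAB i j p q)
    (fun p q => by
      have := hAB' p q k l
      rw [← sub_eq_zero] at this
      rw [← this]; abel)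
  simp only [add_mul, mul_sub, Finset.sum_add_distrib, Finset.sum_sub_distrib] at this
  rw [← sub_eq_zero, ← this]

lemma LeftAntisymm.mul_left {A A' B B' : Matrix (Fin 3) (Fin 3) S}
    (hAB' : LeftAntisymm A' B') (hAB : PreservesAntisymm A B) (h : EntriesCommute A' B) :
    LeftAntisymm (A * A') (B * B') := by
  intro i j k l
  simp only [mul_apply_mul_mul_apply h, ← Finset.sum_add_distrib, ← add_mul]
  exact sum_symm_mul_antisymm (U := fun p q => A i p * B j q + A j p * B i q)
    (V := fun p q => A' p k * B' q l) (fun p q => hAB i j p q) (fun p q => hAB' p q k l)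

lemma RightSymm.mul_right {A A' B B' : Matrix (Fin 3) (Fin 3) S}
    (hAB : RightSymm A B) (hAB' : PreservesAntisymm A' B') (h : EntriesCommute A' B) :
    RightSymm (A * A') (B * B') := by
  intro i j k l
  simp only [mul_apply_mul_mul_apply h]
  have := sum_symm_mul_antisymm (U := fun p q => A i p * B j q)
    (V := fun p q => A' p k * B' q l - A' p l * B' q k)
    (fun p q => hAB i j p q)
    (fun p q => by
      have := hAB' p q k l
      rw [← sub_eq_zero] at this
      rw [← this]; abel)
  simp only [mul_sub, Finset.sum_sub_distrib] at this
  rwa [sub_eq_zero] at this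

/-- The trace `tr₁₂ (P⁻₁₂ A₁ B₂)`. -/
def antisymmTrace (A B : Matrix (Fin 3) (Fin 3) S) : S :=
  (2 : ℂ)⁻¹ • ∑ i, ∑ j, (A i i * B j j - A i j * B j i)

lemma RightSymm.antisymmTrace_eq_zero {A B : Matrix (Fin 3) (Fin 3) S} (h : RightSymm A B) :
    antisymmTrace A B = 0 := by
  simp only [antisymmTrace, h _ _ _ _, sub_self, Finset.sum_const_zero, smul_zero]

lemma LeftAntisymm.antisymmTrace_eq {A B : Matrix (Fin 3) (Fin 3) S} (h : LeftAntisymm A B) :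
    antisymmTrace A B = A.trace * B.trace := by
  have h' : ∀ i j, A j i * B i j = - (A i i * B j j) := fun i j =>
    eq_neg_of_add_eq_zero_right (h i j i j)
  rw [antisymmTrace]
  simp only [Finset.sum_sub_distrib]
  nth_rewrite 2 [Finset.sum_comm]
  simp only [h', Finset.sum_neg_distrib, sub_neg_eq_add]
  rw [← two_smul ℂ, smul_smul, inv_mul_cancel₀ two_ne_zero, one_smul]
  simp [Matrix.trace, Finset.sum_mul_sum]

/-- The matrix with scalar entries `K`. -/
def scalarMat (K : Matrix (Fin 3) (Fin 3) ℂ) : Matrix (Fin 3) (Fin 3) S :=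
  K.map (algebraMap ℂ S)

lemma entriesCommute_scalarMat_right (K : Matrix (Fin 3) (Fin 3) ℂ)
    (A : Matrix (Fin 3) (Fin 3) S) : EntriesCommute A (scalarMat K) :=
  fun i j k l => (Algebra.commutes (K k l) (A i j)).symm

lemma preservesAntisymm_scalarMat (K : Matrix (Fin 3) (Fin 3) ℂ) :
    PreservesAntisymm (scalarMat K : Matrix (Fin 3) (Fin 3) S) (scalarMat K) := by
  intro i j k l
  simp only [scalarMat, Matrix.map_apply, ← map_mul, ← map_add]
  congr 1
  ring

lemma preservesAntisymm_one :
    PreservesAntisymm (1 : Matrix (Fin 3) (Fin 3) S) 1 := by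
  have := preservesAntisymm_scalarMat (S := S) 1
  rwa [scalarMat, Matrix.map_one _ (map_zero _) (map_one _)] at this

lemma sum_mul_antisymm_eq_zero {K : Matrix (Fin 3) (Fin 3) ℂ} (hK : K.det = 0)
    {y : Fin 3 → Fin 3 → Fin 3 → S} (h12 : ∀ i j k, y i j k + y j i k = 0)
    (h23 : ∀ i j k, y i j k + y i k j = 0) (i j k : Fin 3) :
    ∑ p, ∑ q, ∑ r, (K i p * K j q * K k r) • y p q r = 0 := by
  have hself : ∀ x : S, x + x = 0 → x = 0 := by
    intro x hx
    rw [← two_smul ℂ x] at hx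
    exact (smul_eq_zero_iff_right (two_ne_zero)).1 hx
  have e1 : ∀ i k, y i i k = 0 := fun i k => hself _ (h12 i i k)
  have e2 : ∀ i k, y i k k = 0 := fun i k => hself _ (h23 i k k)
  have n12 : ∀ i j k, y i j k = - y j i k := fun i j k => eq_neg_of_add_eq_zero_left (h12 i j k)
  have n23 : ∀ i j k, y i j k = - y i k j := fun i j k => eq_neg_of_add_eq_zero_left (h23 i j k)
  have e3 : ∀ i k, y i k i = 0 := fun i k => by rw [n23, e1, neg_zero]
  have a1 : y 0 2 1 = - y 0 1 2 := n23 _ _ _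
  have a2 : y 1 0 2 = - y 0 1 2 := n12 _ _ _
  have a3 : y 1 2 0 = y 0 1 2 := by rw [n23, a2, neg_neg]
  have a4 : y 2 0 1 = y 0 1 2 := by rw [n12, a1, neg_neg]
  have a5 : y 2 1 0 = - y 0 1 2 := by rw [n23, a4]
  have hdet : (K.submatrix ![i, j, k] id).det = 0 := by
    have : K.submatrix ![i, j, k] id
        = (1 : Matrix (Fin 3) (Fin 3) ℂ).submatrix ![i, j, k] id * K := by
      ext a b
      rw [Matrix.mul_apply]
      simp only [Matrix.submatrix_apply, Matrix.one_apply, id, ite_mul, one_mul, zero_mul,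
        Finset.sum_ite_eq, Finset.mem_univ, if_true]
    rw [this, Matrix.det_mul, hK, mul_zero]
  rw [Matrix.det_fin_three] at hdet
  simp only [Matrix.submatrix_apply, id] at hdet
  simp only [Fin.sum_univ_three, e1, e2, e3, a1, a2, a3, a4, a5, smul_zero, add_zero, zero_add,
    smul_neg, ← neg_smul, ← add_smul]
  rw [← zero_smul ℂ (y 0 1 2), ← hdet]
  congr 1
  simp
  ring

/-- Three matrices with `A₁ B₂ C₃ P⁻₂₃` antisymmetric in all left indices: multiplying by a
singular twist annihilates the fused product. -/
lemma trace_mul_antisymmTrace_eq_zero {K : Matrix (Fin 3) (Fin 3) ℂ} (hK : K.det = 0)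
    {A B C : Matrix (Fin 3) (Fin 3) S} (hAB : LeftAntisymm A B) (hBC : PreservesAntisymm B C) :
    (scalarMat K * A).trace * antisymmTrace (scalarMat K * B) (scalarMat K * C) = 0 := by
  obtain ⟨A', hA'⟩ : ∃ A' : Matrix (Fin 3) (Fin 3) S, A' = scalarMat K * A := ⟨_, rfl⟩
  obtain ⟨B', hB'⟩ : ∃ B' : Matrix (Fin 3) (Fin 3) S, B' = scalarMat K * B := ⟨_, rfl⟩
  obtain ⟨C', hC'⟩ : ∃ C' : Matrix (Fin 3) (Fin 3) S, C' = scalarMat K * C := ⟨_, rfl⟩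
  have key : ∀ i j k a b c, A' i a * (B' j b * C' k c - B' j c * C' k b) = 0 := by
    intro i j k a b c
    rw [← sum_mul_antisymm_eq_zero hK
      (y := fun p q r => A p a * (B q b * C r c - B q c * C r b)) ?_ ?_ i j k]
    · simp only [hA', hB', hC', scalarMat, Matrix.mul_apply, Matrix.map_apply,
        Algebra.algebraMap_eq_smul_one, smul_mul_assoc, one_mul, Finset.sum_mul_sum,
        mul_smul_comm, smul_smul, ← Finset.sum_sub_distrib, ← smul_sub]
      simp only [Finset.mul_sum, mul_smul_comm, Finset.smul_sum, smul_smul, mul_assoc]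
      simp only [mul_comm]
    · intro p q r
      have h1 := hAB p q a b
      have h2 := hAB p q a c
      simp only [mul_sub, ← mul_assoc]
      calc _ = (A p a * B q b + A q a * B p b) * C r c
            - (A p a * B q c + A q a * B p c) * C r b := by noncomm_ring
        _ = 0 := by rw [h1, h2, zero_mul, zero_mul, sub_zero]
    · intro p q r
      rw [← mul_add]
      convert mul_zero _ using 2
      have := hBC q r b c
      rw [← sub_eq_zero] at this
      rw [← this]
      abel
  rw [← hA', ← hB', ← hC', antisymmTrace, Matrix.trace, mul_smul_comm, Finset.sum_mul_sum]
  simp only [Matrix.diag_apply, Finset.mul_sum]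
  simp only [key, Finset.sum_const_zero, smul_zero]

end Fusion
/-! ### The monodromy matrix as a `3 × 3` matrix of operators -/

/-- The elementary matrix `E_{ab}` acting on the `n`-th site. -/
def siteUnit (n : Fin N) (a b : Fin 3) : Op N :=
  Matrix.of fun f g => if g n = b ∧ f = Function.update g n a then 1 else 0

lemma siteUnit_mul_siteUnit (n : Fin N) (a b c d : Fin 3) :
    siteUnit n a b * siteUnit n c d = if b = c then siteUnit n a d else 0 := by
  ext f g
  rw [Matrix.mul_apply, Finset.sum_eq_single (Function.update g n c)]
  · by_cases hbc : b = c
    · subst hbc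
      by_cases hg : g n = d <;> simp [siteUnit, hg]
    · simp [siteUnit, hbc, Ne.symm hbc]
  · intro h _ hh
    simp [siteUnit, hh]
  · simp

lemma siteUnit_commute {n m : Fin N} (hnm : n ≠ m) (a b c d : Fin 3) :
    Commute (siteUnit n a b) (siteUnit m c d) := by
  ext f g
  rw [Matrix.mul_apply, Matrix.mul_apply, Finset.sum_eq_single (Function.update g m c),
    Finset.sum_eq_single (Function.update g n a)]
  · simp only [siteUnit, Matrix.of_apply, Function.update_of_ne hnm, Function.update_of_ne hnm.symm,
      Function.update_comm hnm, and_true]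
    by_cases h1 : g n = b <;> by_cases h2 : g m = d <;> simp [h1, h2]
  · intro h _ hh
    simp [siteUnit, hh]
  · simp
  · intro h _ hh
    simp [siteUnit, hh]
  · simp

/-- The `L`-operator of site `n`, as a `3 × 3` matrix of operators. -/
def siteL (η : ℂ) (ξ : Fin N → ℂ) (lam : ℂ) (n : Fin N) : Matrix (Fin 3) (Fin 3) (Op N) :=
  Matrix.of fun i k => (if i = k then lam - ξ n else 0) • (1 : Op N) + η • siteUnit n k i

/-- The product of the `L`-operators along a list of sites. -/
def listL (η : ℂ) (ξ : Fin N → ℂ) (lam : ℂ) (l : List (Fin N)) : Matrix (Fin 3) (Fin 3) (Op N) :=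
  (l.map (siteL η ξ lam)).prod

/-- The monodromy matrix with identity twist. -/
def monoL (η : ℂ) (ξ : Fin N → ℂ) (lam : ℂ) : Matrix (Fin 3) (Fin 3) (Op N) :=
  listL η ξ lam (List.finRange N).reverse

lemma entriesCommute_siteL (η : ℂ) (ξ : Fin N → ℂ) (lam mu : ℂ) {n m : Fin N} (hnm : n ≠ m) :
    EntriesCommute (siteL η ξ lam n) (siteL η ξ mu m) := by
  intro i j k l
  simp only [siteL, Matrix.of_apply]
  refine Commute.add_left ?_ (Commute.add_right ?_ ?_)
  · exact (Commute.one_left _).smul_left _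
  · exact (Commute.one_right _).smul_right _
  · exact ((siteUnit_commute hnm _ _ _ _).smul_left _).smul_right _

lemma entriesCommute_siteL_listL (η : ℂ) (ξ : Fin N → ℂ) (lam mu : ℂ) {n : Fin N}
    {l : List (Fin N)} (h : n ∉ l) : EntriesCommute (siteL η ξ lam n) (listL η ξ mu l) := by
  induction l with
  | nil => exact entriesCommute_one_right _
  | cons m l ih =>
    rw [List.mem_cons, not_or] at h
    rw [listL, List.map_cons, List.prod_cons]
    exact (entriesCommute_siteL η ξ lam mu h.1).mul_right (ih h.2)

lemma entriesCommute_listL_listL (η : ℂ) (ξ : Fin N → ℂ) (lam mu : ℂ) {l l' : List (Fin N)}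
    (h : l.Disjoint l') : EntriesCommute (listL η ξ lam l) (listL η ξ mu l') := by
  induction l with
  | nil => exact entriesCommute_one_left _
  | cons m l ih =>
    rw [List.disjoint_cons_left] at h
    rw [listL, List.map_cons, List.prod_cons]
    exact (entriesCommute_siteL_listL η ξ lam mu h.1).mul_left (ih h.2)

lemma siteL_mul_siteL (η : ℂ) (ξ : Fin N → ℂ) (lam mu : ℂ) (n : Fin N) (i j k l : Fin 3) :
    siteL η ξ lam n i k * siteL η ξ mu n j l =
      ((if i = k then 1 else 0) * (if j = l then 1 else 0) * (lam - ξ n) * (mu - ξ n)) • (1 : Op N)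
        + (η * (lam - ξ n) * (if i = k then 1 else 0)) • siteUnit n l j
        + (η * (mu - ξ n) * (if j = l then 1 else 0)) • siteUnit n k i
        + (η ^ 2 * (if i = l then 1 else 0)) • siteUnit n k j := by
  simp only [siteL, Matrix.of_apply, add_mul, mul_add, smul_mul_smul_comm, mul_one, one_mul,
    siteUnit_mul_siteUnit]
  split_ifs <;> simp <;> module

lemma preservesAntisymm_siteL (η : ℂ) (ξ : Fin N → ℂ) (lam : ℂ) (n : Fin N) :
    PreservesAntisymm (siteL η ξ lam n) (siteL η ξ (lam - η) n) := by
  intro i j k l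
  simp only [siteL_mul_siteL]
  module

lemma leftAntisymm_siteL (η : ℂ) (ξ : Fin N → ℂ) (n : Fin N) :
    LeftAntisymm (siteL η ξ (ξ n) n) (siteL η ξ (ξ n - η) n) := by
  intro i j k l
  simp only [siteL_mul_siteL]
  module

lemma rightSymm_siteL (η : ℂ) (ξ : Fin N → ℂ) (n : Fin N) :
    RightSymm (siteL η ξ (ξ n + η) n) (siteL η ξ (ξ n) n) := by
  intro i j k l
  simp only [siteL_mul_siteL]
  module

lemma preservesAntisymm_listL (η : ℂ) (ξ : Fin N → ℂ) (lam : ℂ) {l : List (Fin N)}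
    (h : l.Nodup) : PreservesAntisymm (listL η ξ lam l) (listL η ξ (lam - η) l) := by
  induction l with
  | nil => exact preservesAntisymm_one
  | cons n l ih =>
    rw [List.nodup_cons] at h
    rw [listL, listL, List.map_cons, List.prod_cons, List.map_cons, List.prod_cons]
    exact (preservesAntisymm_siteL η ξ lam n).mul (ih h.2)
      fun i j k l => (entriesCommute_siteL_listL η ξ _ _ h.1 k l i j).symm

lemma preservesAntisymm_monoL (η : ℂ) (ξ : Fin N → ℂ) (lam : ℂ) :
    PreservesAntisymm (monoL η ξ lam) (monoL η ξ (lam - η)) :=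
  preservesAntisymm_listL η ξ lam (List.nodup_reverse.2 (List.nodup_finRange N))

lemma exists_monoL_split (n : Fin N) : ∃ l₁ l₂ : List (Fin N), n ∉ l₁ ∧ n ∉ l₂ ∧ l₁.Disjoint l₂ ∧
    l₁.Nodup ∧ l₂.Nodup ∧ ∀ (η : ℂ) (ξ : Fin N → ℂ) (lam : ℂ),
      monoL η ξ lam = listL η ξ lam l₁ * (siteL η ξ lam n * listL η ξ lam l₂) := by
  obtain ⟨l₁, l₂, hl⟩ := List.append_of_mem
    (List.mem_reverse.2 (List.mem_finRange n))
  have hnd : (l₁ ++ n :: l₂).Nodup := hl ▸ List.nodup_reverse.2 (List.nodup_finRange N)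
  rw [List.nodup_append'] at hnd
  obtain ⟨h1, h2, h3⟩ := hnd
  rw [List.nodup_cons] at h2
  rw [List.disjoint_cons_right] at h3
  refine ⟨l₁, l₂, h3.1, h2.1, h3.2, h1, h2.2, fun η ξ lam => ?_⟩
  rw [monoL, hl, listL, List.map_append, List.prod_append, List.map_cons, List.prod_cons]
  rfl

lemma EntriesCommute.symm {S : Type*} [Ring S] {A B : Matrix (Fin 3) (Fin 3) S}
    (h : EntriesCommute A B) : EntriesCommute B A := fun i j k l => (h k l i j).symm

lemma leftAntisymm_monoL (η : ℂ) (ξ : Fin N → ℂ) (n : Fin N) :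
    LeftAntisymm (monoL η ξ (ξ n)) (monoL η ξ (ξ n - η)) := by
  obtain ⟨l₁, l₂, h1, h2, h12, n1, -, hM⟩ := exists_monoL_split n
  rw [hM, hM]
  refine LeftAntisymm.mul_left (LeftAntisymm.mul_right (leftAntisymm_siteL η ξ n) ?_)
    (preservesAntisymm_listL η ξ _ n1) ?_
  · exact (entriesCommute_siteL_listL η ξ _ _ h2).symm
  · exact (entriesCommute_siteL_listL η ξ _ _ h1).mul_left
      (entriesCommute_listL_listL η ξ _ _ h12.symm)

lemma rightSymm_monoL (η : ℂ) (ξ : Fin N → ℂ) (n : Fin N) :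
    RightSymm (monoL η ξ (ξ n + η)) (monoL η ξ (ξ n)) := by
  obtain ⟨l₁, l₂, h1, h2, h12, -, n2, hM⟩ := exists_monoL_split n
  rw [hM, hM]
  refine RightSymm.mul_left (RightSymm.mul_right (rightSymm_siteL η ξ n) ?_ ?_) ?_
  · simpa using preservesAntisymm_listL η ξ (ξ n + η) n2
  · exact (entriesCommute_siteL_listL η ξ _ _ h2).symm
  · exact (entriesCommute_siteL_listL η ξ _ _ h1).mul_left
      (entriesCommute_listL_listL η ξ _ _ h12.symm)

/-! ### The transfer matrices in terms of operator-valued matrices -/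

/-- The `3 × 3` matrix of operators underlying an operator on `V_a ⊗ H`. -/
def block : Matrix (Fin 3 × St N) (Fin 3 × St N) ℂ ≃+* Matrix (Fin 3) (Fin 3) (Op N) :=
  (Matrix.compRingEquiv (Fin 3) (St N) ℂ).symm

lemma block_apply (M : Matrix (Fin 3 × St N) (Fin 3 × St N) ℂ) (i j : Fin 3) (f g : St N) :
    block M i j f g = M (i, f) (j, g) := rfl

lemma block_Raux (η : ℂ) (ξ : Fin N → ℂ) (lam : ℂ) (n : Fin N) :
    block (Raux η ξ lam n) = siteL η ξ lam n := by
  ext i j f g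
  simp only [block_apply, Raux, siteL, siteUnit, Matrix.of_apply, Matrix.add_apply,
    Matrix.smul_apply, Matrix.one_apply, Prod.mk.injEq, smul_eq_mul]
  by_cases hij : i = j <;> by_cases hfg : f = g <;> simp [hij, hfg, eq_comm]

lemma block_Kaux (K : Matrix (Fin 3) (Fin 3) ℂ) :
    block (Kaux K : Matrix (Fin 3 × St N) (Fin 3 × St N) ℂ) = scalarMat K := by
  ext i j f g
  simp [block_apply, Kaux, scalarMat, Matrix.algebraMap_matrix_apply]

lemma block_monodromy (η : ℂ) (ξ : Fin N → ℂ) (K : Matrix (Fin 3) (Fin 3) ℂ) (lam : ℂ) :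
    block (monodromy η ξ K lam) = scalarMat K * monoL η ξ lam := by
  rw [monodromy, map_mul, block_Kaux, map_list_prod, List.ofFn_eq_map, ← List.map_reverse,
    List.map_map, monoL, listL]
  simp only [Function.comp_def, block_Raux]

lemma T1_eq_trace (η : ℂ) (ξ : Fin N → ℂ) (K : Matrix (Fin 3) (Fin 3) ℂ) (lam : ℂ) :
    T1 η ξ K lam = (scalarMat K * monoL η ξ lam).trace := by
  rw [← block_monodromy]
  ext f g
  simp [T1, Matrix.trace, Matrix.sum_apply, block_apply]

lemma emb1_mul_emb2_apply (M M' : Matrix (Fin 3 × St N) (Fin 3 × St N) ℂ) (i j k l : Fin 3)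
    (f g : St N) : (emb1 M * emb2 M') ((i, j), f) ((k, l), g)
      = (block M i k * block M' j l) f g := by
  simp only [Matrix.mul_apply, Fintype.sum_prod_type, emb1, emb2, Matrix.of_apply, block_apply]
  simp [Finset.sum_ite_eq, mul_ite, ite_mul]

lemma antisym2_mul_apply (X : Matrix ((Fin 3 × Fin 3) × St N) ((Fin 3 × Fin 3) × St N) ℂ)
    (i j : Fin 3) (f : St N) (q : (Fin 3 × Fin 3) × St N) :
    ((antisym2 : Matrix ((Fin 3 × Fin 3) × St N) ((Fin 3 × Fin 3) × St N) ℂ) * X) ((i, j), f) q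
      = 2⁻¹ * (X ((i, j), f) q - X ((j, i), f) q) := by
  have h : ∀ a : Fin 3 × Fin 3, ((i, j) = (a.2, a.1)) ↔ ((j, i) = a) := fun a => by
    simp only [Prod.ext_iff, and_comm]
  simp only [Matrix.mul_apply, Fintype.sum_prod_type (α₁ := Fin 3 × Fin 3), antisym2,
    Matrix.of_apply, h]
  simp [ite_mul, sub_mul, mul_sub, Finset.sum_sub_distrib]

lemma T2_eq_antisymmTrace (η : ℂ) (ξ : Fin N → ℂ) (K : Matrix (Fin 3) (Fin 3) ℂ) (lam : ℂ) :
    T2 η ξ K lam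
      = antisymmTrace (scalarMat K * monoL η ξ lam) (scalarMat K * monoL η ξ (lam - η)) := by
  rw [← block_monodromy, ← block_monodromy]
  generalize hA : monodromy η ξ K lam = A
  generalize hB : monodromy η ξ K (lam - η) = B
  ext f g
  rw [T2, hA, hB, Matrix.mul_assoc, Matrix.of_apply, Fintype.sum_prod_type]
  simp only [antisym2_mul_apply, emb1_mul_emb2_apply, antisymmTrace, Matrix.smul_apply,
    Matrix.sum_apply, Matrix.sub_apply, smul_eq_mul, Finset.mul_sum, mul_sub, Finset.sum_sub_distrib]
  rw [Finset.sum_comm (f := fun i j => 2⁻¹ * (block A j i * block B i j) f g)]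

/-- `T₂` vanishes at the shifted inhomogeneities. -/
lemma T2_add_eta (η : ℂ) (ξ : Fin N → ℂ) (K : Matrix (Fin 3) (Fin 3) ℂ) (n : Fin N) :
    T2 η ξ K (ξ n + η) = 0 := by
  rw [T2_eq_antisymmTrace, add_sub_cancel_right]
  exact RightSymm.antisymmTrace_eq_zero
    ((rightSymm_monoL η ξ n).mul_left (entriesCommute_scalarMat_right _ _))

lemma T1_mul_T1 (η : ℂ) (ξ : Fin N → ℂ) (K : Matrix (Fin 3) (Fin 3) ℂ) (n : Fin N) :
    T1 η ξ K (ξ n) * T1 η ξ K (ξ n - η) = T2 η ξ K (ξ n) := by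
  rw [T2_eq_antisymmTrace, T1_eq_trace, T1_eq_trace]
  exact (LeftAntisymm.antisymmTrace_eq ((leftAntisymm_monoL η ξ n).mul_left
    (preservesAntisymm_scalarMat K) (entriesCommute_scalarMat_right _ _))).symm

lemma T1_mul_T2_eq_zero (η : ℂ) (ξ : Fin N → ℂ) {K : Matrix (Fin 3) (Fin 3) ℂ} (hK : K.det = 0)
    (n : Fin N) : T1 η ξ K (ξ n) * T2 η ξ K (ξ n - η) = 0 := by
  rw [T2_eq_antisymmTrace, T1_eq_trace]
  exact trace_mul_antisymmTrace_eq_zero hK (leftAntisymm_monoL η ξ n)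
    (preservesAntisymm_monoL η ξ _)
/-! ### Polynomial dependence on the spectral parameter -/

/-- `F` is a polynomial function of degree at most `n` whose coefficient of degree `n` is `c`. -/
def IsPolyLead (F : ℂ → ℂ) (n : ℕ) (c : ℂ) : Prop :=
  ∃ p : Polynomial ℂ, p.natDegree ≤ n ∧ p.coeff n = c ∧ ∀ x, F x = p.eval x

lemma IsPolyLead.add {F G : ℂ → ℂ} {n : ℕ} {c d : ℂ} (hF : IsPolyLead F n c)
    (hG : IsPolyLead G n d) : IsPolyLead (fun x => F x + G x) n (c + d) := by
  obtain ⟨p, hp, rfl, hpF⟩ := hF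
  obtain ⟨q, hq, rfl, hqG⟩ := hG
  exact ⟨p + q, Polynomial.natDegree_add_le_of_degree_le hp hq, Polynomial.coeff_add _ _ _,
    fun x => by simp only [hpF, hqG, Polynomial.eval_add]⟩

lemma IsPolyLead.mul {F G : ℂ → ℂ} {n m : ℕ} {c d : ℂ} (hF : IsPolyLead F n c)
    (hG : IsPolyLead G m d) : IsPolyLead (fun x => F x * G x) (n + m) (c * d) := by
  obtain ⟨p, hp, rfl, hpF⟩ := hF
  obtain ⟨q, hq, rfl, hqG⟩ := hG
  exact ⟨p * q, Polynomial.natDegree_mul_le_of_le hp hq,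
    Polynomial.coeff_mul_add_eq_of_natDegree_le hp hq,
    fun x => by simp only [hpF, hqG, Polynomial.eval_mul]⟩

lemma isPolyLead_const (c : ℂ) : IsPolyLead (fun _ => c) 0 c :=
  ⟨Polynomial.C c, by simp, by simp, by simp⟩

lemma isPolyLead_zero (n : ℕ) : IsPolyLead (fun _ => 0) n 0 :=
  ⟨0, by simp, by simp, by simp⟩

lemma IsPolyLead.const_mul {F : ℂ → ℂ} {n : ℕ} {c : ℂ} (hF : IsPolyLead F n c) (d : ℂ) :
    IsPolyLead (fun x => d * F x) n (d * c) := by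
  simpa using (isPolyLead_const d).mul hF

lemma IsPolyLead.sum {κ : Type*} (s : Finset κ) {F : κ → ℂ → ℂ} {n : ℕ} {c : κ → ℂ}
    (hF : ∀ k ∈ s, IsPolyLead (F k) n (c k)) :
    IsPolyLead (fun x => ∑ k ∈ s, F k x) n (∑ k ∈ s, c k) := by
  classical
  induction s using Finset.induction_on with
  | empty => simpa using isPolyLead_zero n
  | insert a s ha ih =>
    simp only [Finset.sum_insert ha]
    exact (hF a (Finset.mem_insert_self a s)).add
      (ih fun k hk => hF k (Finset.mem_insert_of_mem hk))

lemma IsPolyLead.comp_sub {F : ℂ → ℂ} {n : ℕ} {c : ℂ} (hF : IsPolyLead F n c) (η : ℂ) :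
    IsPolyLead (fun x => F (x - η)) n c := by
  obtain ⟨p, hp, rfl, hpF⟩ := hF
  have hlin : (Polynomial.X - Polynomial.C η : Polynomial ℂ).natDegree = 1 :=
    Polynomial.natDegree_X_sub_C η
  have hdeg : (p.comp (Polynomial.X - Polynomial.C η)).natDegree = p.natDegree := by
    rw [Polynomial.natDegree_comp, hlin, mul_one]
  refine ⟨p.comp (Polynomial.X - Polynomial.C η), hdeg.le.trans hp, ?_, fun x => by simp [hpF]⟩
  rcases hp.lt_or_eq with h | h
  · rw [Polynomial.coeff_eq_zero_of_natDegree_lt (hdeg.trans_lt h),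
      Polynomial.coeff_eq_zero_of_natDegree_lt h]
  · rw [← h]
    nth_rewrite 1 [← hdeg]
    rw [Polynomial.coeff_natDegree, Polynomial.leadingCoeff_comp (by simp [hlin]),
      Polynomial.leadingCoeff_X_sub_C, one_pow, mul_one, Polynomial.coeff_natDegree]

/-- The Lagrange basis polynomial of index `a` for the nodes `v`, evaluated at `x`. -/
def lagr {M : ℕ} (v : Fin M → ℂ) (x : ℂ) (a : Fin M) : ℂ :=
  ∏ b ∈ Finset.univ.erase a, (x - v b) / (v a - v b)

lemma IsPolyLead.eq_interpolation {M : ℕ} {F : ℂ → ℂ} {c : ℂ} (hF : IsPolyLead F M c)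
    {v : Fin M → ℂ} (hv : Function.Injective v) (x : ℂ) :
    F x = c * ∏ a, (x - v a) + ∑ a, lagr v x a * F (v a) := by
  obtain ⟨p, hp, rfl, hpF⟩ := hF
  have hnod : (Lagrange.nodal Finset.univ v).natDegree = M := by simp [Lagrange.natDegree_nodal]
  have hdeg : (p - Polynomial.C (p.coeff M) * Lagrange.nodal Finset.univ v).degree
      < (Finset.univ : Finset (Fin M)).card := by
    rw [Finset.card_univ, Fintype.card_fin, Polynomial.degree_lt_iff_coeff_zero]
    intro m hm
    rw [Polynomial.coeff_sub, Polynomial.coeff_C_mul]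
    rcases hm.lt_or_eq with h | h
    · rw [Polynomial.coeff_eq_zero_of_natDegree_lt (hp.trans_lt h),
        Polynomial.coeff_eq_zero_of_natDegree_lt (hnod.trans_lt h), mul_zero, sub_zero]
    · have h1 : (Lagrange.nodal Finset.univ v).coeff M = 1 := by
        have := (Lagrange.nodal_monic (s := Finset.univ) (v := v)).coeff_natDegree
        rwa [hnod] at this
      rw [← h, h1, mul_one, sub_self]
  have h := congrArg (Polynomial.eval x)
    (Lagrange.eq_interpolate (s := Finset.univ) (v := v) hv.injOn hdeg)
  simp only [Polynomial.eval_sub, Polynomial.eval_mul, Polynomial.eval_C, Lagrange.eval_nodal,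
    Lagrange.interpolate_apply, Polynomial.eval_finsetSum, Lagrange.basis, Polynomial.eval_prod,
    Lagrange.basisDivisor, Polynomial.eval_X] at h
  rw [hpF, ← sub_eq_iff_eq_add', h]
  refine Finset.sum_congr rfl fun a _ => ?_
  rw [hpF, Finset.prod_eq_zero (Finset.mem_univ a) (sub_self (v a)), mul_zero, sub_zero, mul_comm,
    lagr]
  congr 1
  exact Finset.prod_congr rfl fun b _ => by rw [div_eq_inv_mul]

lemma IsPolyLead.exists_eq_mul {M n : ℕ} {F : ℂ → ℂ} {c : ℂ} (hF : IsPolyLead F (M + n) c)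
    {u : Fin M → ℂ} (hu : Function.Injective u) (h0 : ∀ a, F (u a) = 0) :
    ∃ G : ℂ → ℂ, IsPolyLead G n c ∧ ∀ x, F x = (∏ a, (x - u a)) * G x := by
  obtain ⟨p, hp, rfl, hpF⟩ := hF
  have hdvd : Lagrange.nodal Finset.univ u ∣ p := by
    rw [Lagrange.nodal]
    refine Finset.prod_dvd_of_coprime (fun i _ j _ hij => ?_) fun a _ => ?_
    · exact Polynomial.pairwise_coprime_X_sub_C hu hij
    · rw [Polynomial.dvd_iff_isRoot, Polynomial.IsRoot, ← hpF, h0]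
  obtain ⟨q, rfl⟩ := hdvd
  have hmon : (Lagrange.nodal Finset.univ u).Monic := Lagrange.nodal_monic
  have hnod : (Lagrange.nodal Finset.univ u).natDegree = M := by simp [Lagrange.natDegree_nodal]
  have hq : q.natDegree ≤ n := by
    rcases eq_or_ne q 0 with rfl | hq0
    · simp
    · rw [hmon.natDegree_mul' hq0, hnod] at hp
      omega
  refine ⟨fun x => q.eval x, ⟨q, hq, ?_, fun _ => rfl⟩, fun x => ?_⟩
  · rw [Polynomial.coeff_mul_add_eq_of_natDegree_le hnod.le hq]
    have := hmon.coeff_natDegree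
    rw [hnod] at this
    rw [this, one_mul]
  · rw [hpF, Polynomial.eval_mul, Lagrange.eval_nodal]

/-- The operator `F` is polynomial of degree at most `n` in the spectral parameter, with
coefficient of degree `n` equal to the scalar `c`. -/
def OpPolyLead (F : ℂ → Op N) (n : ℕ) (c : ℂ) : Prop :=
  ∀ f g, IsPolyLead (fun x => F x f g) n (c * (1 : Op N) f g)

lemma OpPolyLead.add {F G : ℂ → Op N} {n : ℕ} {c d : ℂ} (hF : OpPolyLead F n c)
    (hG : OpPolyLead G n d) : OpPolyLead (fun x => F x + G x) n (c + d) := fun f g => by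
  simpa only [Matrix.add_apply, add_mul] using (hF f g).add (hG f g)

lemma OpPolyLead.smul {F : ℂ → Op N} {n : ℕ} {c : ℂ} (hF : OpPolyLead F n c) (d : ℂ) :
    OpPolyLead (fun x => d • F x) n (d * c) := fun f g => by
  simpa only [Matrix.smul_apply, smul_eq_mul, mul_assoc] using (hF f g).const_mul d

lemma OpPolyLead.mul {F G : ℂ → Op N} {n m : ℕ} {c d : ℂ} (hF : OpPolyLead F n c)
    (hG : OpPolyLead G m d) : OpPolyLead (fun x => F x * G x) (n + m) (c * d) := fun f g => by
  have h := IsPolyLead.sum Finset.univ fun (k : St N) _ => (hF f k).mul (hG k g)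
  have e : (c * d) * (1 : Op N) f g
      = ∑ k, c * (1 : Op N) f k * (d * (1 : Op N) k g) := by
    rw [← one_mul (1 : Op N), Matrix.mul_apply, Finset.mul_sum, one_mul]
    exact Finset.sum_congr rfl fun k _ => by ring
  rw [e]
  simpa only [Matrix.mul_apply] using h

lemma OpPolyLead.sum {κ : Type*} (s : Finset κ) {F : κ → ℂ → Op N} {n : ℕ} {c : κ → ℂ}
    (hF : ∀ k ∈ s, OpPolyLead (F k) n (c k)) :
    OpPolyLead (fun x => ∑ k ∈ s, F k x) n (∑ k ∈ s, c k) := fun f g => by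
  simpa only [Matrix.sum_apply, Finset.sum_mul] using IsPolyLead.sum s fun k hk => hF k hk f g

lemma OpPolyLead.isPolyLead_eigenvalue {F : ℂ → Op N} {n : ℕ} {c : ℂ} (hF : OpPolyLead F n c)
    {w : Hsp N} (hw : w ≠ 0) {t : ℂ → ℂ} (ht : ∀ x, Matrix.mulVec (F x) w = t x • w) :
    IsPolyLead t n c := by
  obtain ⟨f, hf⟩ := Function.ne_iff.1 hw
  rw [Pi.zero_apply] at hf
  have h := IsPolyLead.sum Finset.univ fun (k : St N) _ => (hF f k).const_mul ((w f)⁻¹ * w k)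
  have hc : ∑ k, (w f)⁻¹ * w k * (c * (1 : Op N) f k) = c := by
    simp only [Matrix.one_apply, mul_ite, mul_one, mul_zero, Finset.sum_ite_eq, Finset.mem_univ,
      if_true]
    field_simp
  rw [hc] at h
  convert h using 2 with x
  have := congrFun (ht x) f
  rw [Matrix.mulVec, dotProduct, Pi.smul_apply, smul_eq_mul] at this
  rw [eq_div_of_mul_eq hf this.symm, div_eq_inv_mul, Finset.mul_sum]
  exact Finset.sum_congr rfl fun k _ => by ring

/-- All entries of a `3 × 3` matrix of operators are polynomial in the spectral parameter, with
scalar top coefficients. -/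
def MatPolyLead (A : ℂ → Matrix (Fin 3) (Fin 3) (Op N)) (n : ℕ) (C : Matrix (Fin 3) (Fin 3) ℂ) :
    Prop := ∀ i j, OpPolyLead (fun x => A x i j) n (C i j)

lemma MatPolyLead.mul {A B : ℂ → Matrix (Fin 3) (Fin 3) (Op N)} {n m : ℕ}
    {C D : Matrix (Fin 3) (Fin 3) ℂ} (hA : MatPolyLead A n C) (hB : MatPolyLead B m D) :
    MatPolyLead (fun x => A x * B x) (n + m) (C * D) := fun i j => by
  simpa only [Matrix.mul_apply] using
    OpPolyLead.sum Finset.univ fun (k : Fin 3) _ => (hA i k).mul (hB k j)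

lemma opPolyLead_const_smul_one (c : ℂ) : OpPolyLead (fun _ => c • (1 : Op N)) 0 c :=
  fun _ _ => isPolyLead_const _

lemma matPolyLead_scalarMat (K : Matrix (Fin 3) (Fin 3) ℂ) :
    MatPolyLead (fun _ => (scalarMat K : Matrix (Fin 3) (Fin 3) (Op N))) 0 K := fun i j => by
  simpa only [scalarMat, Matrix.map_apply, Algebra.algebraMap_eq_smul_one] using
    opPolyLead_const_smul_one (K i j)

lemma matPolyLead_siteL (η : ℂ) (ξ : Fin N → ℂ) (n : Fin N) :
    MatPolyLead (fun x => siteL η ξ x n) 1 1 := fun i j f g => by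
  refine ⟨Polynomial.C ((1 : Matrix (Fin 3) (Fin 3) ℂ) i j * (1 : Op N) f g) * Polynomial.X
    + Polynomial.C ((1 : Matrix (Fin 3) (Fin 3) ℂ) i j * (1 : Op N) f g * (- ξ n)
      + η * siteUnit n j i f g), ?_, ?_, fun x => ?_⟩
  · exact Polynomial.natDegree_linear_le
  · simp
  · simp only [siteL, Matrix.of_apply, Matrix.add_apply, Matrix.smul_apply, smul_eq_mul,
      Polynomial.eval_add, Polynomial.eval_mul, Polynomial.eval_C, Polynomial.eval_X]
    rw [Matrix.one_apply (i := i)]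
    split_ifs <;> ring

lemma matPolyLead_listL (η : ℂ) (ξ : Fin N → ℂ) (l : List (Fin N)) :
    MatPolyLead (fun x => listL η ξ x l) l.length 1 := by
  induction l with
  | nil =>
    have h := matPolyLead_scalarMat (N := N) 1
    rwa [scalarMat, Matrix.map_one _ (map_zero _) (map_one _)] at h
  | cons n l ih =>
    have h := (matPolyLead_siteL η ξ n).mul ih
    rw [one_mul, add_comm] at h
    exact h

lemma matPolyLead_monodromy (η : ℂ) (ξ : Fin N → ℂ) (K : Matrix (Fin 3) (Fin 3) ℂ) :
    MatPolyLead (fun x => scalarMat K * monoL η ξ x) N K := by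
  simpa [monoL] using
    (matPolyLead_scalarMat K).mul (matPolyLead_listL η ξ (List.finRange N).reverse)

lemma opPolyLead_T1 (η : ℂ) (ξ : Fin N → ℂ) (K : Matrix (Fin 3) (Fin 3) ℂ) :
    OpPolyLead (T1 η ξ K) N K.trace := by
  have h := OpPolyLead.sum Finset.univ fun (i : Fin 3) _ => matPolyLead_monodromy η ξ K i i
  intro f g
  convert h f g using 2 with x
  · rw [T1_eq_trace]
    rfl
  · rfl

lemma exists_opPolyLead_T2 (η : ℂ) (ξ : Fin N → ℂ) (K : Matrix (Fin 3) (Fin 3) ℂ) :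
    ∃ c, OpPolyLead (T2 η ξ K) (N + N) c := by
  have hM := matPolyLead_monodromy η ξ K
  have hM' : MatPolyLead (fun x => scalarMat K * monoL η ξ (x - η)) N K :=
    fun i j f g => (hM i j f g).comp_sub η
  have h := (OpPolyLead.sum Finset.univ fun (i : Fin 3) _ =>
    OpPolyLead.sum Finset.univ fun (j : Fin 3) _ =>
      ((hM i i).mul (hM' j j)).add (((hM i j).mul (hM' j i)).smul (-1))).smul 2⁻¹
  refine ⟨2⁻¹ * ∑ i, ∑ j, (K i i * K j j + -1 * (K i j * K j i)), fun f g => ?_⟩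
  convert h f g using 2 with x
  rw [T2_eq_antisymmTrace, antisymmTrace]
  simp only [neg_smul, one_smul, sub_eq_add_neg]
/-! ### Vandermonde products -/

lemma Vdm_eq_mul_prod_erase {M : ℕ} (w : Fin M → ℂ) (n : Fin M) :
    Vdm w = (∏ j ∈ Finset.univ.erase n, ∏ i ∈ Finset.univ.erase n,
        if i < j then w j - w i else 1) *
      ∏ a ∈ Finset.univ.erase n, ((if n < a then -1 else 1) * (w n - w a)) := by
  have hj : ∀ j, ∏ i ∈ Finset.univ.filter (fun i => i < j), (w j - w i)
      = (if n < j then w j - w n else 1)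
        * ∏ i ∈ Finset.univ.erase n, (if i < j then w j - w i else 1) := fun j => by
    rw [Finset.prod_filter]
    exact (Finset.mul_prod_erase _ _ (Finset.mem_univ n)).symm
  simp only [Vdm, hj]
  rw [← Finset.mul_prod_erase _ _ (Finset.mem_univ n), if_neg (lt_irrefl n), one_mul,
    Finset.prod_mul_distrib, mul_comm, mul_right_comm, mul_comm, ← Finset.prod_mul_distrib]
  congr 1
  refine Finset.prod_congr rfl fun a ha => ?_
  rcases lt_or_gt_of_ne (Finset.ne_of_mem_erase ha) with h | h
  · simp [h, h.not_gt]
  · simp [h, h.not_gt]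

lemma Vdm_mul_prod_update {M : ℕ} (v : Fin M → ℂ) (n : Fin M) (s : ℂ) :
    Vdm v * ∏ a ∈ Finset.univ.erase n, (s - v a)
      = Vdm (Function.update v n s) * ∏ a ∈ Finset.univ.erase n, (v n - v a) := by
  have h1 : ∏ j ∈ Finset.univ.erase n, ∏ i ∈ Finset.univ.erase n,
        (if i < j then Function.update v n s j - Function.update v n s i else 1)
      = ∏ j ∈ Finset.univ.erase n, ∏ i ∈ Finset.univ.erase n, if i < j then v j - v i else 1 :=
    Finset.prod_congr rfl fun j hj => Finset.prod_congr rfl fun i hi => by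
      rw [Function.update_of_ne (Finset.ne_of_mem_erase hj),
        Function.update_of_ne (Finset.ne_of_mem_erase hi)]
  have h2 : ∏ a ∈ Finset.univ.erase n, (Function.update v n s n - Function.update v n s a)
      = ∏ a ∈ Finset.univ.erase n, (s - v a) :=
    Finset.prod_congr rfl fun a ha => by
      rw [Function.update_of_ne (Finset.ne_of_mem_erase ha), Function.update_self]
  rw [Vdm_eq_mul_prod_erase v n, Vdm_eq_mul_prod_erase _ n, h1, Finset.prod_mul_distrib,
    Finset.prod_mul_distrib, h2]
  ring

lemma Vdm_ne_zero {M : ℕ} {v : Fin M → ℂ} (hv : Function.Injective v) : Vdm v ≠ 0 := by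
  refine Finset.prod_ne_zero_iff.2 fun j _ => Finset.prod_ne_zero_iff.2 fun i hi => ?_
  exact sub_ne_zero.2 fun h => (Finset.mem_filter.1 hi).2.ne (hv h).symm

lemma lagr_eq_Vdm_div {M : ℕ} {v : Fin M → ℂ} (hv : Function.Injective v) (n : Fin M) (s : ℂ) :
    lagr v s n = Vdm (Function.update v n s) / Vdm v := by
  have h0 : ∏ a ∈ Finset.univ.erase n, (v n - v a) ≠ 0 :=
    Finset.prod_ne_zero_iff.2 fun a ha =>
      sub_ne_zero.2 fun h => (Finset.ne_of_mem_erase ha) (hv h).symm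
  rw [lagr, Finset.prod_div_distrib, div_eq_div_iff h0 (Vdm_ne_zero hv), ← Vdm_mul_prod_update,
    mul_comm]

/-- Shifting some of the inhomogeneities by `η` keeps them distinct. -/
lemma InhomCond.injective_shift {η : ℂ} {ξ : Fin N → ℂ} (hξ : InhomCond η ξ) {δ : Fin N → ℂ}
    (hδ : ∀ a, δ a = 0 ∨ δ a = 1) : Function.Injective fun a => ξ a - δ a * η := by
  intro i j hij
  by_contra hne
  obtain ⟨h0, h1, h2⟩ := hξ i j hne
  have hij : ξ i - ξ j = (δ i - δ j) * η := by linear_combination hij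
  rcases hδ i with hi | hi <;> rcases hδ j with hj | hj <;> rw [hi, hj] at hij
  · exact h0 (by rw [hij]; ring)
  · exact h2 (by rw [hij]; ring)
  · exact h1 (by rw [hij]; ring)
  · exact h0 (by rw [hij]; ring)

/-! ### Orthogonality from the simplified fusion relations -/

/-- The monomials in `q (s - η)`, `q s` and `t s` which may sit at a site of inhomogeneity `s`
in a scalar product of separated states. -/
inductive Letter
  | y | z | o | x | xx | xz

namespace Letter

variable {A : Type*} [CommRing A] [Algebra ℂ A]

/-- The monomial denoted by a letter. -/
def val (q t : ℂ → A) (η s : ℂ) : Letter → A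
  | y => q (s - η)
  | z => q s
  | o => 1
  | x => t s
  | xx => t s * t s
  | xz => t s * q s

/-- The weight governing the order in which the letters are reduced. -/
def weight : Letter → ℕ
  | y => 0
  | z => 1
  | o => 0
  | x => 0
  | xx => 3
  | xz => 1

/-- The scalar factor contributed by a letter. -/
def coeff (e : ℂ) : Letter → ℂ
  | y => 1
  | z => 1
  | o => 0
  | x => 0
  | xx => e
  | xz => 0

/-- The shift of the interpolation node of `q` attached to a letter. -/
def shiftQ : Letter → ℂ
  | y => 0
  | z => 1
  | o => 1
  | x => 1
  | xx => 1
  | xz => 1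

/-- The shift of the interpolation node of `t` attached to a letter. -/
def shiftT : Letter → ℂ
  | y => 0
  | z => 0
  | o => 0
  | x => 1
  | xx => 1
  | xz => 0

lemma shiftQ_eq (l : Letter) : l.shiftQ = 0 ∨ l.shiftQ = 1 := by cases l <;> simp [shiftQ]

lemma shiftT_eq (l : Letter) : l.shiftT = 0 ∨ l.shiftT = 1 := by cases l <;> simp [shiftT]

end Letter

section Words

open Letter

variable {A : Type*} [CommRing A] [Algebra ℂ A]

/-- The product of the monomials of a word of letters. -/
def wordVal (q t : ℂ → A) (η : ℂ) (ξ : Fin N → ℂ) (w : Fin N → Letter) : A :=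
  ∏ n, (w n).val q t η (ξ n)

/-- The total weight of a word. -/
def wordWeight (w : Fin N → Letter) : ℕ := ∑ n, (w n).weight

/-- The value of the normalized functional on a word. -/
def wordMeasure (η : ℂ) (ξ e : Fin N → ℂ) (w : Fin N → Letter) : ℂ :=
  (∏ n, (w n).coeff (e n)) * (Vdm ξ ^ 2 /
    (Vdm (fun a => ξ a - (w a).shiftQ * η) * Vdm (fun a => ξ a - (w a).shiftT * η)))

lemma wordWeight_update (w : Fin N → Letter) (n : Fin N) (l : Letter) :
    wordWeight (Function.update w n l) + (w n).weight = wordWeight w + l.weight := by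
  have h := Finset.add_sum_erase Finset.univ (fun m => (w m).weight) (Finset.mem_univ n)
  have h' := Finset.add_sum_erase Finset.univ (fun m => (Function.update w n l m).weight)
    (Finset.mem_univ n)
  have e : ∑ m ∈ Finset.univ.erase n, (Function.update w n l m).weight
      = ∑ m ∈ Finset.univ.erase n, (w m).weight :=
    Finset.sum_congr rfl fun m hm => by rw [Function.update_of_ne (Finset.ne_of_mem_erase hm)]
  simp only [Function.update_self, e] at h'
  simp only [wordWeight]
  omega

lemma mul_wordVal (q t : ℂ → A) (η : ℂ) (ξ : Fin N → ℂ) (w : Fin N → Letter) (n : Fin N)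
    {F : A} {c : ℂ} {l : Letter}
    (h : F * (w n).val q t η (ξ n) = c • l.val q t η (ξ n)) :
    F * wordVal q t η ξ w = c • wordVal q t η ξ (Function.update w n l) := by
  have e : ∏ m ∈ Finset.univ.erase n, (Function.update w n l m).val q t η (ξ m)
      = ∏ m ∈ Finset.univ.erase n, (w m).val q t η (ξ m) :=
    Finset.prod_congr rfl fun m hm => by rw [Function.update_of_ne (Finset.ne_of_mem_erase hm)]
  rw [wordVal, wordVal, ← Finset.mul_prod_erase _ _ (Finset.mem_univ n), ← mul_assoc, h,
    ← Finset.mul_prod_erase Finset.univ (fun m => (Function.update w n l m).val q t η (ξ m))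
      (Finset.mem_univ n), e, Function.update_self, smul_mul_assoc]

lemma mul_wordVal_eq_zero (q t : ℂ → A) (η : ℂ) (ξ : Fin N → ℂ) (w : Fin N → Letter) (n : Fin N)
    {F : A} (h : F * (w n).val q t η (ξ n) = 0) : F * wordVal q t η ξ w = 0 := by
  rw [mul_wordVal q t η ξ w n (c := 0) (l := o) (by rw [h, zero_smul]), zero_smul]

lemma wordMeasure_eq_zero (η : ℂ) (ξ e : Fin N → ℂ) (w : Fin N → Letter) (n : Fin N)
    (h : (w n).coeff (e n) = 0) : wordMeasure η ξ e w = 0 := by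
  rw [wordMeasure, Finset.prod_eq_zero (Finset.mem_univ n) h, zero_mul]

lemma prod_coeff_update (e : Fin N → ℂ) (w : Fin N → Letter) (n : Fin N) {c : ℂ} {l : Letter}
    (h : (w n).coeff (e n) = c * l.coeff (e n)) :
    ∏ m, (w m).coeff (e m) = c * ∏ m, (Function.update w n l m).coeff (e m) := by
  have he : ∏ m ∈ Finset.univ.erase n, (Function.update w n l m).coeff (e m)
      = ∏ m ∈ Finset.univ.erase n, (w m).coeff (e m) :=
    Finset.prod_congr rfl fun m hm => by rw [Function.update_of_ne (Finset.ne_of_mem_erase hm)]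
  rw [← Finset.mul_prod_erase _ _ (Finset.mem_univ n),
    ← Finset.mul_prod_erase Finset.univ (fun m => (Function.update w n l m).coeff (e m))
      (Finset.mem_univ n), he, Function.update_self, h, mul_assoc]

lemma wordMeasure_of_eq_z {η : ℂ} {ξ : Fin N → ℂ} (hξ : InhomCond η ξ) (e : Fin N → ℂ)
    {w : Fin N → Letter} {n : Fin N} (hw : w n = z) :
    wordMeasure η ξ e w = lagr (fun a => ξ a - (w a).shiftQ * η) (ξ n) n
      * wordMeasure η ξ e (Function.update w n y) := by
  have h1 := hξ.injective_shift fun a => (w a).shiftQ_eq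
  have hQ : (fun a => ξ a - (Function.update w n y a).shiftQ * η)
      = Function.update (fun a => ξ a - (w a).shiftQ * η) n (ξ n) := by
    ext a
    rcases eq_or_ne a n with rfl | ha
    · simp [shiftQ]
    · simp [ha]
  have hT : (fun a => ξ a - (Function.update w n y a).shiftT * η)
      = fun a => ξ a - (w a).shiftT * η := by
    ext a
    rcases eq_or_ne a n with rfl | ha
    · simp [shiftT, hw]
    · simp [ha]
  have h2 : Vdm (Function.update (fun a => ξ a - (w a).shiftQ * η) n (ξ n)) ≠ 0 := by
    rw [← hQ]
    exact Vdm_ne_zero (hξ.injective_shift fun a => (Function.update w n y a).shiftQ_eq)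
  rw [wordMeasure, wordMeasure, hQ, hT, lagr_eq_Vdm_div h1,
    prod_coeff_update e w n (c := 1) (l := y) (by simp [hw, coeff])]
  have h3 := Vdm_ne_zero h1
  generalize Vdm (Function.update (fun a => ξ a - (w a).shiftQ * η) n (ξ n)) = V₁ at *
  generalize Vdm (fun a => ξ a - (w a).shiftQ * η) = V₂ at *
  generalize Vdm (fun a => ξ a - (w a).shiftT * η) = V₃
  field_simp

lemma wordMeasure_of_eq_xx {η : ℂ} {ξ : Fin N → ℂ} (hξ : InhomCond η ξ) (e : Fin N → ℂ)
    {w : Fin N → Letter} {n : Fin N} (hw : w n = xx) :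
    wordMeasure η ξ e w = lagr (fun a => ξ a - (w a).shiftT * η) (ξ n) n
      * (e n * wordMeasure η ξ e (Function.update w n z)) := by
  have h1 := hξ.injective_shift fun a => (w a).shiftT_eq
  have hT : (fun a => ξ a - (Function.update w n z a).shiftT * η)
      = Function.update (fun a => ξ a - (w a).shiftT * η) n (ξ n) := by
    ext a
    rcases eq_or_ne a n with rfl | ha
    · simp [shiftT]
    · simp [ha]
  have hQ : (fun a => ξ a - (Function.update w n z a).shiftQ * η)
      = fun a => ξ a - (w a).shiftQ * η := by
    ext a
    rcases eq_or_ne a n with rfl | ha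
    · simp [shiftQ, hw]
    · simp [ha]
  have h2 : Vdm (Function.update (fun a => ξ a - (w a).shiftT * η) n (ξ n)) ≠ 0 := by
    rw [← hT]
    exact Vdm_ne_zero (hξ.injective_shift fun a => (Function.update w n z a).shiftT_eq)
  rw [wordMeasure, wordMeasure, hQ, hT, lagr_eq_Vdm_div h1,
    prod_coeff_update e w n (c := e n) (l := z) (by simp [hw, coeff])]
  have h3 := Vdm_ne_zero h1
  generalize Vdm (Function.update (fun a => ξ a - (w a).shiftT * η) n (ξ n)) = V₁ at *
  generalize Vdm (fun a => ξ a - (w a).shiftT * η) = V₂ at *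
  generalize Vdm (fun a => ξ a - (w a).shiftQ * η) = V₃
  field_simp

/-- `F` obeys the Lagrange interpolation formula of degree `N` with leading coefficient `κ`. -/
def Interpolates (N : ℕ) (F : ℂ → A) (κ : ℂ) : Prop :=
  ∀ v : Fin N → ℂ, Function.Injective v → ∀ s,
    F s = algebraMap ℂ A (κ * ∏ a, (s - v a)) + ∑ a, lagr v s a • F (v a)

lemma Interpolates.apply_mul {F : ℂ → A} {κ : ℂ} (hF : Interpolates N F κ) {v : Fin N → ℂ}
    (hv : Function.Injective v) (s : ℂ) (n : Fin N) (ω : A →ₗ[ℂ] ℂ) {W : A} (hW : ω W = 0)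
    (h : ∀ a, a ≠ n → ω (F (v a) * W) = 0) :
    ω (F s * W) = lagr v s n * ω (F (v n) * W) := by
  rw [hF v hv s, add_mul, Finset.sum_mul, map_add, map_sum, ← Algebra.smul_def, map_smul, hW,
    smul_zero, zero_add, Finset.sum_eq_single n (fun a _ ha => by
      rw [smul_mul_assoc, map_smul, h a ha, smul_zero]) (fun h => absurd (Finset.mem_univ n) h),
    smul_mul_assoc, map_smul, smul_eq_mul]

theorem apply_wordVal_eq_wordMeasure {η : ℂ} {ξ : Fin N → ℂ} (hξ : InhomCond η ξ)
    (e : Fin N → ℂ) {q t : ℂ → A} {κq κt : ℂ} (hq : Interpolates N q κq)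
    (ht : Interpolates N t κt) (hqt : ∀ n, q (ξ n - η) * t (ξ n) = 0)
    (hqq : ∀ n, q (ξ n - η) * q (ξ n) = 0)
    (htt : ∀ n, t (ξ n) * t (ξ n - η) = e n • q (ξ n))
    (ω : A →ₗ[ℂ] ℂ) {c₀ : ℂ} (hy : ω (wordVal q t η ξ fun _ => y) = c₀)
    (hbase : ∀ w : Fin N → Letter, (∀ n, w n = y ∨ w n = o ∨ w n = x) → (∃ n, w n ≠ y) →
      ω (wordVal q t η ξ w) = 0) (w : Fin N → Letter) :
    ω (wordVal q t η ξ w) = c₀ * wordMeasure η ξ e w := by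
  induction hk : wordWeight w using Nat.strong_induction_on generalizing w with
  | _ k ih =>
  subst hk
  have bad : ∀ (u : Fin N → Letter) (n : Fin N), wordWeight u < wordWeight w →
      (u n).coeff (e n) = 0 → ω (wordVal q t η ξ u) = 0 := fun u n hu h => by
    rw [ih _ hu u rfl, wordMeasure_eq_zero η ξ e u n h, mul_zero]
  -- the nodes of `q` adapted to `w` kill every interpolated term but the one at site `n`
  have hq_term : ∀ n l, l.weight < (w n).weight → l.coeff (e n) = 0 → ∀ a ≠ n,
      ω (q (ξ a - (w a).shiftQ * η) * wordVal q t η ξ (Function.update w n l)) = 0 := by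
    intro n l hwl hln a ha
    have hwt := wordWeight_update w n l
    have hua : Function.update w n l a = w a := Function.update_of_ne ha _ _
    by_cases hao : w a = o
    · have hwt' := wordWeight_update (Function.update w n l) a y
      rw [mul_wordVal q t η ξ _ a (c := 1) (l := y) (by simp [hua, hao, val, shiftQ]), one_smul]
      refine bad _ n ?_ (by rw [Function.update_of_ne ha.symm, Function.update_self, hln])
      simp only [weight] at hwt'
      omega
    · rw [mul_wordVal_eq_zero q t η ξ _ a, map_zero]
      rw [hua]
      cases hwa : w a
      · simpa [val, shiftQ, mul_comm] using hqq a
      · simpa [val, shiftQ] using hqq a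
      · exact absurd hwa hao
      · simpa [val, shiftQ] using hqt a
      · simp [val, shiftQ, ← mul_assoc, hqt a]
      · simp [val, shiftQ, ← mul_assoc, hqt a]
  by_cases hz : ∃ n, w n = z
  · obtain ⟨n, hn⟩ := hz
    have hwt := wordWeight_update w n o
    have hwy := wordWeight_update w n y
    simp only [hn, weight] at hwt hwy
    have hW : q (ξ n) * wordVal q t η ξ (Function.update w n o) = wordVal q t η ξ w := by
      rw [mul_wordVal q t η ξ _ n (c := 1) (l := z) (by simp [val]), one_smul,
        Function.update_idem, ← hn, Function.update_eq_self]
    have hY : q (ξ n - (w n).shiftQ * η) * wordVal q t η ξ (Function.update w n o)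
        = wordVal q t η ξ (Function.update w n y) := by
      rw [mul_wordVal q t η ξ _ n (c := 1) (l := y) (by simp [val, hn, shiftQ]), one_smul,
        Function.update_idem]
    have := hq.apply_mul (hξ.injective_shift fun a => (w a).shiftQ_eq) (ξ n) n ω
      (bad (Function.update w n o) n (by omega) (by simp [coeff]))
      (hq_term n o (by simp [hn, weight]) rfl)
    rw [hW, hY, ih _ (by omega) (Function.update w n y) rfl] at this
    rw [this, wordMeasure_of_eq_z hξ e hn]
    ring
  by_cases hxz : ∃ n, w n = xz
  · obtain ⟨n, hn⟩ := hxz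
    have hwt := wordWeight_update w n x
    simp only [hn, weight] at hwt
    have hW : q (ξ n) * wordVal q t η ξ (Function.update w n x) = wordVal q t η ξ w := by
      rw [mul_wordVal q t η ξ _ n (c := 1) (l := xz) (by simp [val, mul_comm]), one_smul,
        Function.update_idem, ← hn, Function.update_eq_self]
    have := hq.apply_mul (hξ.injective_shift fun a => (w a).shiftQ_eq) (ξ n) n ω
      (bad (Function.update w n x) n (by omega) (by simp [coeff]))
      (hq_term n x (by simp [hn, weight]) rfl)
    rw [hW, mul_wordVal_eq_zero q t η ξ _ n (by simp [val, hn, shiftQ, hqt]), map_zero,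
      mul_zero] at this
    rw [this, wordMeasure_eq_zero η ξ e w n (by simp [hn, coeff]), mul_zero]
  by_cases hxx : ∃ n, w n = xx
  · obtain ⟨n, hn⟩ := hxx
    have hwt := wordWeight_update w n x
    have hwz := wordWeight_update w n z
    simp only [hn, weight] at hwt hwz
    have hW : t (ξ n) * wordVal q t η ξ (Function.update w n x) = wordVal q t η ξ w := by
      rw [mul_wordVal q t η ξ _ n (c := 1) (l := xx) (by simp [val]), one_smul,
        Function.update_idem, ← hn, Function.update_eq_self]
    have hZ : t (ξ n - (w n).shiftT * η) * wordVal q t η ξ (Function.update w n x)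
        = e n • wordVal q t η ξ (Function.update w n z) := by
      rw [mul_wordVal q t η ξ _ n (c := e n) (l := z)
        (by simpa [val, hn, shiftT, mul_comm] using htt n), Function.update_idem]
    have h0 : ∀ a ≠ n,
        ω (t (ξ a - (w a).shiftT * η) * wordVal q t η ξ (Function.update w n x)) = 0 := by
      intro a ha
      have hua : Function.update w n x a = w a := Function.update_of_ne ha _ _
      have hun : ∀ l, (Function.update (Function.update w n x) a l n).coeff (e n) = 0 := fun l => by
        rw [Function.update_of_ne ha.symm, Function.update_self, coeff]
      have hwa' := fun l => wordWeight_update (Function.update w n x) a l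
      rw [hua] at hwa'
      cases hwa : w a
      · rw [mul_wordVal_eq_zero q t η ξ _ a, map_zero]
        simpa [hua, hwa, val, shiftT, mul_comm] using hqt a
      · exact absurd ⟨a, hwa⟩ hz
      · rw [mul_wordVal q t η ξ _ a (c := 1) (l := x) (by simp [hua, hwa, val, shiftT]), one_smul]
        refine bad _ n ?_ (hun _)
        have := hwa' x
        simp only [hwa, weight] at this
        omega
      · rw [mul_wordVal q t η ξ _ a (c := e a) (l := z)
          (by simpa [hua, hwa, val, shiftT, mul_comm] using htt a), map_smul,
          bad _ n ?_ (hun _), smul_zero]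
        have := hwa' z
        simp only [hwa, weight] at this
        omega
      · rw [mul_wordVal q t η ξ _ a (c := e a) (l := xz)
          (by
            simp only [hua, hwa, val, shiftT, one_mul]
            rw [← mul_assoc, mul_comm (t (ξ a - η)), htt, smul_mul_assoc, mul_comm]), map_smul,
          bad _ n ?_ (hun _), smul_zero]
        have := hwa' xz
        simp only [hwa, weight] at this
        omega
      · exact absurd ⟨a, hwa⟩ hxz
    have := ht.apply_mul (hξ.injective_shift fun a => (w a).shiftT_eq) (ξ n) n ω
      (bad (Function.update w n x) n (by omega) (by simp [coeff])) h0
    rw [hW, hZ, map_smul, ih _ (by omega) (Function.update w n z) rfl, smul_eq_mul] at this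
    rw [this, wordMeasure_of_eq_xx hξ e hn]
    ring
  have hletters : ∀ n, w n = y ∨ w n = o ∨ w n = x := fun n => by
    have h1 := not_exists.1 hz n
    have h2 := not_exists.1 hxz n
    have h3 := not_exists.1 hxx n
    cases hwn : w n <;> simp_all
  by_cases hwy : ∃ n, w n ≠ y
  · obtain ⟨n, hn⟩ := hwy
    rw [hbase w hletters ⟨n, hn⟩, wordMeasure_eq_zero η ξ e w n, mul_zero]
    rcases (hletters n).resolve_left hn with h | h <;> simp [h, coeff]
  · have hwy : w = fun _ => y := funext fun n => by
      by_contra h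
      exact hwy ⟨n, h⟩
    have hV : Vdm ξ ≠ 0 := by
      simpa using Vdm_ne_zero (hξ.injective_shift (δ := fun _ => 0) fun _ => Or.inl rfl)
    rw [hwy, hy, wordMeasure]
    simp [coeff, shiftQ, shiftT, sq, hV]

end Words
/-! ### Operators diagonal in a biorthogonal pair of bases -/

lemma pair_eq_dotProduct (L v : Hsp N) : pair L v = dotProduct L v := rfl

lemma pair_smul_left (c : ℂ) (L v : Hsp N) : pair (c • L) v = c * pair L v :=
  smul_dotProduct c L v

lemma pair_smul_right (c : ℂ) (L v : Hsp N) : pair L (c • v) = c * pair L v :=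
  dotProduct_smul c L v

lemma pair_vecMul (L v : Hsp N) (X : Op N) :
    pair (Matrix.vecMul L X) v = pair L (Matrix.mulVec X v) :=
  (Matrix.dotProduct_mulVec L X v).symm

lemma IsBasisFamily.op_ext {va : St N → Hsp N} (hva : IsBasisFamily va) {X Y : Op N}
    (h : ∀ i, Matrix.mulVec X (va i) = Matrix.mulVec Y (va i)) : X = Y := by
  refine Matrix.mulVec_injective (funext fun v => ?_)
  have : Matrix.mulVecLin X = Matrix.mulVecLin Y := LinearMap.ext_on_range hva.2 h
  exact LinearMap.congr_fun this v

/-- The operator with eigenvectors `va`, eigencovectors `ca` and eigenvalues `θ`. -/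
def spectralOp (va ca : St N → Hsp N) (θ : St N → ℂ) : Op N :=
  ∑ a : St N, (θ a * (pair (ca a) (va a))⁻¹) • Matrix.vecMulVec (va a) (ca a)

lemma spectralOp_mulVec {va ca : St N → Hsp N} (hnorm : ∀ i, pair (ca i) (va i) ≠ 0)
    (hbi : ∀ i j, i ≠ j → pair (ca i) (va j) = 0) (θ : St N → ℂ) (j : St N) :
    Matrix.mulVec (spectralOp va ca θ) (va j) = θ j • va j := by
  rw [spectralOp, Matrix.sum_mulVec, Finset.sum_eq_single j]
  · rw [Matrix.smul_mulVec, Matrix.vecMulVec_mulVec, ← pair_eq_dotProduct]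
    ext f
    simp only [Pi.smul_apply, op_smul_eq_smul, smul_eq_mul]
    field_simp [hnorm j]
  · intro i _ hij
    rw [Matrix.smul_mulVec, Matrix.vecMulVec_mulVec, ← pair_eq_dotProduct, hbi i j hij]
    simp
  · exact fun h => absurd (Finset.mem_univ j) h

lemma IsBasisFamily.eq_spectralOp {va ca : St N → Hsp N} (hva : IsBasisFamily va)
    (hnorm : ∀ i, pair (ca i) (va i) ≠ 0) (hbi : ∀ i j, i ≠ j → pair (ca i) (va j) = 0)
    {X : Op N} {θ : St N → ℂ} (h : ∀ i, Matrix.mulVec X (va i) = θ i • va i) :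
    X = spectralOp va ca θ :=
  hva.op_ext fun i => by rw [h, spectralOp_mulVec hnorm hbi]

/-- The algebra homomorphism `θ ↦ spectralOp va ca θ` for biorthogonal bases. -/
def spectralHom (va ca : St N → Hsp N) (hva : IsBasisFamily va)
    (hnorm : ∀ i, pair (ca i) (va i) ≠ 0) (hbi : ∀ i j, i ≠ j → pair (ca i) (va j) = 0) :
    (St N → ℂ) →ₐ[ℂ] Op N :=
  AlgHom.ofLinearMap
    { toFun := spectralOp va ca
      map_add' := fun θ φ => by
        simp only [spectralOp, Pi.add_apply, add_mul, add_smul, Finset.sum_add_distrib]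
      map_smul' := fun c θ => by
        simp only [spectralOp, Pi.smul_apply, smul_eq_mul, mul_assoc, mul_smul, Finset.smul_sum,
          RingHom.id_apply] }
    (hva.eq_spectralOp hnorm hbi fun i => by simp).symm
    fun θ φ => (hva.eq_spectralOp hnorm hbi fun i => by
      change Matrix.mulVec (spectralOp va ca θ * spectralOp va ca φ) (va i) = _
      rw [← Matrix.mulVec_mulVec, spectralOp_mulVec hnorm hbi, Matrix.mulVec_smul,
        spectralOp_mulVec hnorm hbi, smul_smul, mul_comm, Pi.mul_apply]).symm

lemma pair_eq_zero_of_ne {va ca : St N → Hsp N} {T : ℂ → Op N} {tK : St N → ℂ → ℂ}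
    (hvaE : ∀ i lam, Matrix.mulVec (T lam) (va i) = tK i lam • va i)
    (hcaE : ∀ i lam, Matrix.vecMul (ca i) (T lam) = tK i lam • ca i)
    (htK : Function.Injective tK) (i j : St N) (hij : i ≠ j) : pair (ca i) (va j) = 0 := by
  obtain ⟨lam, hlam⟩ := Function.ne_iff.1 (htK.ne hij)
  have h := pair_vecMul (ca i) (va j) (T lam)
  rw [hvaE, hcaE, pair_smul_left, pair_smul_right, ← sub_eq_zero, ← sub_mul] at h
  exact (mul_eq_zero.1 h).resolve_left (sub_ne_zero.2 hlam)

/-! ### Transfer matrices and their eigenvalues -/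

lemma dfun_sub_eta (η : ℂ) (ξ : Fin N → ℂ) (lam : ℂ) :
    dfun ξ (lam - η) = ∏ a, (lam - (ξ a + η)) :=
  Finset.prod_congr rfl fun a _ => by ring

lemma InhomCond.injective {η : ℂ} {ξ : Fin N → ℂ} (hξ : InhomCond η ξ) :
    Function.Injective ξ := by
  simpa using hξ.injective_shift (δ := fun _ => 0) fun _ => Or.inl rfl

lemma InhomCond.dfun_sub_eta_ne_zero {η : ℂ} (hη : η ≠ 0) {ξ : Fin N → ℂ} (hξ : InhomCond η ξ)
    (n : Fin N) : dfun ξ (ξ n - η) ≠ 0 := by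
  refine Finset.prod_ne_zero_iff.2 fun a _ h => ?_
  rcases eq_or_ne n a with rfl | hna
  · exact hη (by linear_combination -h)
  · exact (hξ n a hna).2.1 (by linear_combination h)

lemma commute_T2 {η : ℂ} (hη : η ≠ 0) {ξ : Fin N → ℂ} (hξ : InhomCond η ξ)
    (K : Matrix (Fin 3) (Fin 3) ℂ) {X : Op N} (hX : ∀ lam, Commute (T1 η ξ K lam) X) (lam : ℂ) :
    Commute (T2 η ξ K lam) X := by
  obtain ⟨c, hc⟩ := exists_opPolyLead_T2 η ξ K
  have hu : Function.Injective fun a => ξ a + η := fun i j h =>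
    hξ.injective (add_right_cancel h)
  have h : T2 η ξ K lam = dfun ξ (lam - η) • ((c * ∏ a, (lam - ξ a)) • (1 : Op N)
      + ∑ a, (lagr ξ lam a / dfun ξ (ξ a - η)) • T2 η ξ K (ξ a)) := by
    ext f g
    obtain ⟨G, hG, hTG⟩ := (hc f g).exists_eq_mul hu fun a => by rw [T2_add_eta, Matrix.zero_apply]
    simp only [← dfun_sub_eta] at hTG
    simp only [Matrix.smul_apply, Matrix.add_apply, Matrix.sum_apply, smul_eq_mul, hTG]
    rw [hG.eq_interpolation hξ.injective lam]
    congr 2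
    · ring
    · refine Finset.sum_congr rfl fun a _ => ?_
      have := hξ.dfun_sub_eta_ne_zero hη a
      field_simp
  rw [h]
  refine (((Commute.one_left X).smul_left _).add_left
    (Commute.sum_left _ _ _ fun a _ => ?_)).smul_left _
  rw [← T1_mul_T1]
  exact ((hX _).mul_left (hX _)).smul_left _

lemma interpolates_pi {ι : Type*} {F : ℂ → ι → ℂ} {c : ℂ}
    (h : ∀ i, IsPolyLead (fun x => F x i) N c) : Interpolates N F c := fun v hv s => by
  funext i
  simpa using (h i).eq_interpolation hv s

section Joint

variable {η : ℂ} {ξ : Fin N → ℂ} {K : Matrix (Fin 3) (Fin 3) ℂ} {w : Hsp N} {t₁ t₂ : ℂ → ℂ}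

lemma eigenvalue_T2_add_eta (hw : w ≠ 0) (h2 : ∀ lam, Matrix.mulVec (T2 η ξ K lam) w = t₂ lam • w)
    (n : Fin N) : t₂ (ξ n + η) = 0 := by
  have h := h2 (ξ n + η)
  rw [T2_add_eta, Matrix.zero_mulVec] at h
  exact (smul_eq_zero.1 h.symm).resolve_right hw

lemma eigenvalue_T1_mul_T1 (hw : w ≠ 0)
    (h1 : ∀ lam, Matrix.mulVec (T1 η ξ K lam) w = t₁ lam • w)
    (h2 : ∀ lam, Matrix.mulVec (T2 η ξ K lam) w = t₂ lam • w)
    (n : Fin N) : t₁ (ξ n) * t₁ (ξ n - η) = t₂ (ξ n) := by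
  have h := h2 (ξ n)
  rw [← T1_mul_T1, ← Matrix.mulVec_mulVec, h1, Matrix.mulVec_smul, h1, smul_smul, mul_comm] at h
  exact smul_left_injective ℂ hw h

lemma eigenvalue_T1_mul_T2 (hK : K.det = 0) (hw : w ≠ 0)
    (h1 : ∀ lam, Matrix.mulVec (T1 η ξ K lam) w = t₁ lam • w)
    (h2 : ∀ lam, Matrix.mulVec (T2 η ξ K lam) w = t₂ lam • w)
    (n : Fin N) : t₁ (ξ n) * t₂ (ξ n - η) = 0 := by
  have h := congrArg (fun X => Matrix.mulVec X w) (T1_mul_T2_eq_zero η ξ hK n)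
  simp only [← Matrix.mulVec_mulVec, h1, h2, Matrix.mulVec_smul, Matrix.zero_mulVec,
    smul_smul] at h
  rw [mul_comm]
  exact (smul_eq_zero.1 h).resolve_right hw

end Joint

/-! ### Words attached to pairs of separated states -/

/-- The letter at a site where the covector has label `k` and the vector has label `h`. -/
def siteLetter (k h : Fin 3) : Letter :=
  ![![.y, .y, .y], ![.o, .z, .x], ![.x, .xz, .xx]] k h

/-- The scalar in front of `siteLetter k h`. -/
def siteScalar (d e : ℂ) (k h : Fin 3) : ℂ :=
  ![![d, 0, 0], ![1, e, 1], ![1, e, 1]] k h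

lemma site_factor {A : Type*} [CommRing A] [Algebra ℂ A] {q t u : ℂ → A} {η s d e : ℂ}
    (hu' : u (s - η) = d • q (s - η)) (hu : u s = e • q s) (hqt : q (s - η) * t s = 0)
    (hqq : q (s - η) * q s = 0) (k h : Fin 3) :
    (u (s - η) ^ (if k = 0 then 1 else 0) * t s ^ (if k = 2 then 1 else 0)) *
      (u s ^ (if h = 1 then 1 else 0) * t s ^ (if h = 2 then 1 else 0))
      = siteScalar d e k h • (siteLetter k h).val q t η s := by
  fin_cases k <;> fin_cases h <;>
    simp [siteScalar, siteLetter, Letter.val, hu, hu', hqt, hqq]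

lemma siteScalar_mul_coeff (d e : ℂ) {k h : Fin 3} (hkh : k ≠ h) :
    siteScalar d e k h * (siteLetter k h).coeff e = 0 := by
  fin_cases k <;> fin_cases h <;> simp_all [siteScalar, siteLetter, Letter.coeff]

lemma siteScalar_mul_coeff_self (d e : ℂ) (h : Fin 3) :
    siteScalar d e h h * (siteLetter h h).coeff e = if h = 0 then d else e := by
  fin_cases h <;> simp [siteScalar, siteLetter, Letter.coeff]

lemma shiftQ_siteLetter_self (h : Fin 3) :
    (siteLetter h h).shiftQ = if h = 0 then 0 else 1 := by
  fin_cases h <;> simp [siteLetter, Letter.shiftQ]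

lemma shiftT_siteLetter_self (h : Fin 3) :
    (siteLetter h h).shiftT = if h = 2 then 1 else 0 := by
  fin_cases h <;> simp [siteLetter, Letter.shiftT]

theorem separated_states_orthogonal {A : Type*} [CommRing A] [Algebra ℂ A] {η : ℂ}
    {ξ : Fin N → ℂ} (hξ : InhomCond η ξ) {d e : Fin N → ℂ} (hd : ∀ n, d n ≠ 0)
    {q t u : ℂ → A} {κq κt : ℂ} (hq : Interpolates N q κq) (ht : Interpolates N t κt)
    (hu' : ∀ n, u (ξ n - η) = d n • q (ξ n - η)) (hu : ∀ n, u (ξ n) = e n • q (ξ n))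
    (hqt : ∀ n, q (ξ n - η) * t (ξ n) = 0) (hqq : ∀ n, q (ξ n - η) * q (ξ n) = 0)
    (htt : ∀ n, t (ξ n) * t (ξ n - η) = e n • q (ξ n)) (ω : A →ₗ[ℂ] ℂ)
    (hω : ∀ k : St N, ω (∏ n, (u (ξ n - η) ^ (if k n = 0 then 1 else 0) *
      t (ξ n) ^ (if k n = 2 then 1 else 0))) = if k = zeroSt then 1 else 0) (h k : St N) :
    ω ((∏ n, (u (ξ n - η) ^ (if k n = 0 then 1 else 0) *
        t (ξ n) ^ (if k n = 2 then 1 else 0))) *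
      ∏ n, (u (ξ n) ^ (if h n = 1 then 1 else 0) * t (ξ n) ^ (if h n = 2 then 1 else 0)))
      = if h = k then (∏ n, if h n = 0 then 1 else e n / d n) * (Vdm ξ ^ 2 /
          (Vdm (fun a => ξ a - (if h a = 0 then 0 else 1 : ℂ) * η) *
            Vdm (fun a => ξ a - (if h a = 2 then 1 else 0 : ℂ) * η))) else 0 := by
  have key : ∀ k h : St N, (∏ n, (u (ξ n - η) ^ (if k n = 0 then 1 else 0) *
        t (ξ n) ^ (if k n = 2 then 1 else 0))) *
      ∏ n, (u (ξ n) ^ (if h n = 1 then 1 else 0) * t (ξ n) ^ (if h n = 2 then 1 else 0))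
      = (∏ n, siteScalar (d n) (e n) (k n) (h n)) •
        wordVal q t η ξ fun n => siteLetter (k n) (h n) := by
    intro k h
    rw [← Finset.prod_mul_distrib, wordVal, ← Finset.prod_smul]
    exact Finset.prod_congr rfl fun n _ => site_factor (hu' n) (hu n) (hqt n) (hqq n) _ _
  have hcov : ∀ k : St N, (∏ n, siteScalar (d n) (e n) (k n) 0) *
      ω (wordVal q t η ξ fun n => siteLetter (k n) 0) = if k = zeroSt then 1 else 0 := fun k => by
    rw [← hω, ← smul_eq_mul, ← map_smul]
    congr 1
    refine (key k fun _ => 0).symm.trans ?_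
    simp
  have hy : (∏ n, d n) * ω (wordVal q t η ξ fun _ => Letter.y) = 1 := by
    simpa [siteScalar, siteLetter, zeroSt] using hcov zeroSt
  have hbase : ∀ w : Fin N → Letter, (∀ n, w n = .y ∨ w n = .o ∨ w n = .x) →
      (∃ n, w n ≠ .y) → ω (wordVal q t η ξ w) = 0 := by
    rintro w hw ⟨m, hm⟩
    have hk : ∀ n, ∃ k : Fin 3, siteLetter k 0 = w n := fun n => by
      rcases hw n with h | h | h <;> rw [h]
      exacts [⟨0, rfl⟩, ⟨1, rfl⟩, ⟨2, rfl⟩]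
    choose k hk using hk
    have h := hcov k
    simp only [hk] at h
    rw [if_neg] at h
    · refine (mul_eq_zero.1 h).resolve_left (Finset.prod_ne_zero_iff.2 fun n _ => ?_)
      generalize k n = l
      fin_cases l <;> simp [siteScalar, hd n]
    · rintro rfl
      exact hm (hk m).symm
  have hmain := apply_wordVal_eq_wordMeasure hξ e hq ht hqt hqq htt ω rfl hbase
  rw [key, map_smul, hmain, smul_eq_mul, wordMeasure]
  split_ifs with hkh
  · subst hkh
    have hc : (∏ n, siteScalar (d n) (e n) (h n) (h n)) * (∏ n, (siteLetter (h n) (h n)).coeff (e n))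
        = (∏ n, d n) * ∏ n, if h n = 0 then 1 else e n / d n := by
      rw [← Finset.prod_mul_distrib, ← Finset.prod_mul_distrib]
      refine Finset.prod_congr rfl fun n _ => ?_
      rw [siteScalar_mul_coeff_self]
      split_ifs
      · rw [mul_one]
      · rw [mul_div_cancel₀ _ (hd n)]
    simp only [shiftQ_siteLetter_self, shiftT_siteLetter_self]
    linear_combination (ω (wordVal q t η ξ fun _ => Letter.y) * (Vdm ξ ^ 2 /
          (Vdm (fun a => ξ a - (if h a = 0 then 0 else 1 : ℂ) * η) *
            Vdm (fun a => ξ a - (if h a = 2 then 1 else 0 : ℂ) * η)))) * hc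
      + ((∏ n, if h n = 0 then 1 else e n / d n) * (Vdm ξ ^ 2 /
          (Vdm (fun a => ξ a - (if h a = 0 then 0 else 1 : ℂ) * η) *
            Vdm (fun a => ξ a - (if h a = 2 then 1 else 0 : ℂ) * η)))) * hy
  · obtain ⟨n, hn⟩ := Function.ne_iff.1 hkh
    have h0 : (∏ n, siteScalar (d n) (e n) (k n) (h n)) *
        ∏ n, (siteLetter (k n) (h n)).coeff (e n) = 0 := by
      rw [← Finset.prod_mul_distrib]
      exact Finset.prod_eq_zero (Finset.mem_univ n) (siteScalar_mul_coeff _ _ hn.symm)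
    linear_combination (ω (wordVal q t η ξ fun _ => Letter.y) * (Vdm ξ ^ 2 /
      (Vdm (fun a => ξ a - (siteLetter (k a) (h a)).shiftQ * η) *
        Vdm (fun a => ξ a - (siteLetter (k a) (h a)).shiftT * η)))) * h0

lemma list_prod_map_algHom {B : Type*} [CommRing B] [Algebra ℂ B] (f : B →ₐ[ℂ] Op N)
    (g : Fin N → B) : (List.ofFn fun n => f (g n)).prod = f (∏ n, g n) := by
  rw [← List.prod_ofFn, map_list_prod, List.map_ofFn]
  rfl

/-- The functional `θ ↦ ⟨L| f θ |R⟩`. -/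
def matrixCoeff {B : Type*} [CommRing B] [Algebra ℂ B] (f : B →ₐ[ℂ] Op N) (L R : Hsp N) :
    B →ₗ[ℂ] ℂ where
  toFun θ := pair (Matrix.vecMul L (f θ)) R
  map_add' θ φ := by
    rw [map_add, Matrix.vecMul_add]
    exact add_dotProduct _ _ _
  map_smul' c θ := by
    rw [map_smul, Matrix.vecMul_smul, pair_smul_left]
    rfl

/-- the conserved charges `𝕋_j^{(K)}` commute among themselves and with the
transfer matrices, satisfy the simplified fusion relations, and generate mutually
orthogonal SoV bases with the `gl₂`-like measure `N_h`. -/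
theorem statement_12 (N : ℕ) (η : ℂ) (hη : η ≠ 0) (ξ : Fin N → ℂ) (hξ : InhomCond η ξ)
    (K Khat P : Matrix (Fin 3) (Fin 3) ℂ) (a b c : ℂ)
    (hP : IsUnit P.det) (ha : a ≠ 0) (hb : b ≠ 0) (hc : c ≠ 0)
    (hab : a ≠ b) (hac : a ≠ c) (hbc : b ≠ c)
    -- `K` is diagonalizable with simple spectrum and nonzero eigenvalues
    (hKD : K = P * Matrix.diagonal ![a, b, c] * P⁻¹)
    -- `K̂` is obtained from `K` by setting one eigenvalue to zero,
    -- keeping simple spectrum and diagonalizability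
    (hKhatD : Khat = P * Matrix.diagonal ![0, b, c] * P⁻¹)
    -- eigenvector and eigenco-vector bases of `T₁^{(K)}`, with simple spectrum
    (va ca : St N → Hsp N) (tK : St N → ℂ → ℂ)
    (hva : IsBasisFamily va) (hca : IsBasisFamily ca)
    (hvaE : ∀ (i : St N) (lam : ℂ),
      Matrix.mulVec (T1 η ξ K lam) (va i) = tK i lam • va i)
    (hcaE : ∀ (i : St N) (lam : ℂ),
      Matrix.vecMul (ca i) (T1 η ξ K lam) = tK i lam • ca i)
    (htKinj : Function.Injective tK)
    (hnorm : ∀ i : St N, pair (ca i) (va i) ≠ 0)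
    -- an enumeration of the joint eigenvalue functions of `T₁^{(K̂)}`, `T₂^{(K̂)}`
    (t1h t2h : St N → ℂ → ℂ)
    (hhat : ∀ i : St N, ∃ w : Hsp N, w ≠ 0 ∧
      (∀ lam, Matrix.mulVec (T1 η ξ Khat lam) w = t1h i lam • w) ∧
      (∀ lam, Matrix.mulVec (T2 η ξ Khat lam) w = t2h i lam • w))
    -- the reference co-vector and the associated reference vector `|0⟩`
    (L R0 : Hsp N)
    (hR0 : ∀ k : St N,
      pair (hatCov η ξ va ca t1h t2h L k) R0 = if k = zeroSt then 1 else 0) :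
    -- (a) commutation relations
    (∀ lam mu : ℂ,
      TTop va ca t1h lam * TTop va ca t1h mu = TTop va ca t1h mu * TTop va ca t1h lam ∧
      TTop va ca t1h lam * TTop va ca t2h mu = TTop va ca t2h mu * TTop va ca t1h lam ∧
      TTop va ca t2h lam * TTop va ca t2h mu = TTop va ca t2h mu * TTop va ca t2h lam ∧
      T1 η ξ K lam * TTop va ca t1h mu = TTop va ca t1h mu * T1 η ξ K lam ∧
      T1 η ξ K lam * TTop va ca t2h mu = TTop va ca t2h mu * T1 η ξ K lam ∧
      T2 η ξ K lam * TTop va ca t1h mu = TTop va ca t1h mu * T2 η ξ K lam ∧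
      T2 η ξ K lam * TTop va ca t2h mu = TTop va ca t2h mu * T2 η ξ K lam) ∧
    -- (b) simplified fusion relations
    (∀ n : Fin N,
      TTop va ca t2h (ξ n - η) * TTop va ca t1h (ξ n) = 0 ∧
      TTop va ca t2h (ξ n - η) * TTop va ca t2h (ξ n) = 0 ∧
      TTop va ca t1h (ξ n - η) * TTop va ca t1h (ξ n) = TTop va ca t2h (ξ n)) ∧
    -- (c) mutual orthogonality of the SoV bases built from `𝕋`
    (∀ h k : St N,
      pair (hatCov η ξ va ca t1h t2h L k) (hatVec η ξ va ca t1h t2h R0 h) =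
        if h = k then Nh η ξ h else 0) := by
  have hbi := pair_eq_zero_of_ne hvaE hcaE htKinj
  set f := spectralHom va ca hva hnorm hbi
  have hTf : ∀ thj lam, TTop va ca thj lam = f fun i => thj i lam := fun _ _ => rfl
  have hKf : ∀ lam, T1 η ξ K lam = f fun i => tK i lam := fun lam =>
    hva.eq_spectralOp hnorm hbi fun i => hvaE i lam
  have hcomm : ∀ θ φ, Commute (f θ) (f φ) := fun θ φ => (Commute.all θ φ).map f
  have hdet : Khat.det = 0 := by
    rw [hKhatD, Matrix.det_mul, Matrix.det_mul, Matrix.det_diagonal]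
    simp [Fin.prod_univ_three]
  choose w hw h1 h2 using hhat
  have h11 : ∀ n, (fun i => t1h i (ξ n)) * (fun i => t1h i (ξ n - η)) = fun i => t2h i (ξ n) :=
    fun n => funext fun i => eigenvalue_T1_mul_T1 (hw i) (h1 i) (h2 i) n
  have h12 : ∀ n, (fun i => t1h i (ξ n)) * (fun i => t2h i (ξ n - η)) = 0 :=
    fun n => funext fun i => eigenvalue_T1_mul_T2 hdet (hw i) (h1 i) (h2 i) n
  have h22 : ∀ n, (fun i => t2h i (ξ n - η)) * (fun i => t2h i (ξ n)) = 0 := fun n => by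
    rw [← h11, ← mul_assoc, mul_comm (fun i => t2h i (ξ n - η)), h12, zero_mul]
  refine ⟨fun lam mu => ?_, fun n => ?_, fun h k => ?_⟩
  · refine ⟨?_, ?_, ?_, ?_, ?_, ?_, ?_⟩
    · exact hcomm _ _
    · exact hcomm _ _
    · exact hcomm _ _
    · rw [hKf]
      exact hcomm _ _
    · rw [hKf]
      exact hcomm _ _
    · exact commute_T2 hη hξ K (fun lam => by rw [hKf]; exact hcomm _ _) lam
    · exact commute_T2 hη hξ K (fun lam => by rw [hKf]; exact hcomm _ _) lam
  · simp only [hTf, ← map_mul]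
    refine ⟨?_, ?_, ?_⟩
    · rw [mul_comm, h12, map_zero]
    · rw [h22, map_zero]
    · rw [mul_comm, h11]
  have hcov : ∀ k, hatCov η ξ va ca t1h t2h L k = Matrix.vecMul L (f (∏ n,
      ((fun i => t2h i (ξ n - η)) ^ (if k n = 0 then 1 else 0) *
        (fun i => t1h i (ξ n)) ^ (if k n = 2 then 1 else 0)))) := fun k => by
    rw [← list_prod_map_algHom]
    simp only [map_mul, map_pow]
    rfl
  have hvec : ∀ k, hatVec η ξ va ca t1h t2h R0 k = Matrix.mulVec (f (∏ n,
      ((fun i => t2h i (ξ n)) ^ (if k n = 1 then 1 else 0) *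
        (fun i => t1h i (ξ n)) ^ (if k n = 2 then 1 else 0)))) R0 := fun k => by
    rw [← list_prod_map_algHom]
    simp only [map_mul, map_pow]
    rfl
  obtain ⟨κ, hκ⟩ := exists_opPolyLead_T2 η ξ Khat
  have hu : Function.Injective fun a => ξ a + η := fun i j h =>
    hξ.injective (add_right_cancel h)
  choose q hq hqu using fun i => ((hκ.isPolyLead_eigenvalue (hw i) (h2 i)).exists_eq_mul hu
    fun a => eigenvalue_T2_add_eta (hw i) (h2 i) a)
  simp only [← dfun_sub_eta] at hqu
  have he : ∀ n, dfun ξ (ξ n - η) ≠ 0 := hξ.dfun_sub_eta_ne_zero hη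
  have hd : ∀ n, dfun ξ (ξ n - η - η) ≠ 0 := fun n hn => by
    have h := hR0 zeroSt
    rw [hcov, Finset.prod_eq_zero (Finset.mem_univ n), map_zero, if_pos rfl] at h
    · simp [pair] at h
    · simp only [zeroSt, if_true, pow_one]
      rw [show (fun i => t2h i (ξ n - η)) = 0 from funext fun i => by simp [hqu, hn], zero_mul]
  have hu' : ∀ lam, (fun i => t2h i lam) = dfun ξ (lam - η) • fun i => q i lam :=
    fun lam => funext fun i => hqu i lam
  have horth := separated_states_orthogonal hξ hd (q := fun lam i => q i lam)
    (t := fun lam i => t1h i lam) (u := fun lam i => t2h i lam) (interpolates_pi hq)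
    (interpolates_pi fun i => (opPolyLead_T1 η ξ Khat).isPolyLead_eigenvalue (hw i) (h1 i))
    (fun n => hu' _) (fun n => hu' _)
    (fun n => by
      have h := h12 n
      rw [hu', mul_comm, smul_mul_assoc] at h
      exact (smul_eq_zero.1 h).resolve_left (hd n))
    (fun n => by
      have h := h22 n
      rw [hu', hu', smul_mul_smul_comm] at h
      exact (smul_eq_zero.1 h).resolve_left (mul_ne_zero (hd n) (he n)))
    (fun n => by rw [← hu', ← h11])
    (matrixCoeff f L R0) (fun k => by rw [← hR0 k, hcov]; rfl) h k
  have hpair : ∀ θ φ, pair (Matrix.vecMul L (f θ)) (Matrix.mulVec (f φ) R0)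
      = matrixCoeff f L R0 (θ * φ) := fun θ φ => by
    rw [← pair_vecMul, Matrix.vecMul_vecMul, ← map_mul]
    rfl
  rw [hcov, hvec, hpair, horth]
  refine if_congr Iff.rfl ?_ rfl
  rw [Nh, mul_div_assoc]
  congr 1
  refine Finset.prod_congr rfl fun n _ => ?_
  split_ifs
  · rw [add_zero, one_mul, div_self (he n)]
  · rw [show ξ n - (1 + 1) * η = ξ n - η - η by ring]

end
end SoV
end

section
/- (Exchange relation for strings of R-matrices.) Let a_{l−1} < a_l < … < a_k < a_{k+1} be site indices in {1,…,N}. Then R̂^{(a_l,…,a_k)}_{a_{l−1}; a_{l−1}+1,…,N} · R̂^{(a_l,…,a_k)}_{a_{k+1}; 1,…,a_{k+1}−1} = n_{a_{k+1}, a_{l−1}} · R̂^{(a_{l−1},…,a_k)}_{a_{k+1}; 1,…,a_{k+1}−1} · R̂^{(a_l,…,a_{k+1})}_{a_{l−1}; a_{l−1}+1,…,N}, where n_{a,b} = η² − (ξ_a − ξ_b)². (This uses only the Yang-Baxter equation and the unitarity R_{a,b} R_{b,a} = (η² − (ξ_a−ξ_b)²)·Id.) -/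
open scoped BigOperators

namespace SoV
noncomputable section
variable {N : ℕ}

/-- The site-site R-matrix `R_{a,b} = R(ξ_a − ξ_b)` acting on the `a`-th and `b`-th tensor
factors of `H`. -/
def Rsite (η : ℂ) (ξ : Fin N → ℂ) (a b : Fin N) : Op N :=
  Matrix.of fun f g =>
    (ξ a - ξ b) * (if f = g then 1 else 0) +
      η * (if f = g ∘ (Equiv.swap a b) then 1 else 0)

/-- The ordered string `R_{a;b₁,…,b_M} = R_{a,b_M} R_{a,b_{M−1}} ⋯ R_{a,b₁}`. -/
def Rstring (η : ℂ) (ξ : Fin N → ℂ) (a : Fin N) (bs : List (Fin N)) : Op N :=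
  (bs.reverse.map fun b => Rsite η ξ a b).prod


/-- The operator on `H` permuting the tensor factors by `σ`. -/
def permOp (σ : Equiv.Perm (Fin N)) : Op N :=
  Matrix.of fun f g => if f = g ∘ σ then 1 else 0

theorem permOp_mul (σ τ : Equiv.Perm (Fin N)) : permOp σ * permOp τ = permOp (τ * σ) := by
  ext f g
  simp only [permOp, Matrix.mul_apply, Matrix.of_apply, mul_ite, mul_one, mul_zero,
    Finset.sum_ite_eq', Finset.mem_univ, if_true, Equiv.Perm.coe_mul]
  rfl

theorem permOp_one : permOp (1 : Equiv.Perm (Fin N)) = 1 := by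
  ext f g
  simp [permOp, Matrix.one_apply]

theorem Rsite_eq (η : ℂ) (ξ : Fin N → ℂ) (a b : Fin N) :
    Rsite η ξ a b = (ξ a - ξ b) • (1 : Op N) + η • permOp (Equiv.swap a b) := by
  ext f g
  simp [Rsite, permOp, Matrix.one_apply]

theorem Rsite_unitarity (η : ℂ) (ξ : Fin N → ℂ) (a b : Fin N) :
    Rsite η ξ a b * Rsite η ξ b a = (η ^ 2 - (ξ b - ξ a) ^ 2) • (1 : Op N) := by
  have h : permOp (Equiv.swap a b) * permOp (Equiv.swap a b) = 1 := by
    rw [permOp_mul, Equiv.swap_mul_self, permOp_one]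
  rw [Rsite_eq, Rsite_eq, Equiv.swap_comm b a]
  simp only [add_mul, mul_add, smul_mul_assoc, mul_smul_comm, one_mul, mul_one, h]
  module

theorem Rsite_commute (η : ℂ) (ξ : Fin N → ℂ) {a b c d : Fin N}
    (hac : a ≠ c) (had : a ≠ d) (hbc : b ≠ c) (hbd : b ≠ d) :
    Commute (Rsite η ξ a b) (Rsite η ξ c d) := by
  have h : Commute (permOp (Equiv.swap a b)) (permOp (Equiv.swap c d)) := by
    have hd : Equiv.swap c d * Equiv.swap a b = Equiv.swap a b * Equiv.swap c d := by
      ext x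
      simp only [Equiv.Perm.coe_mul, Function.comp_apply, Equiv.swap_apply_def]
      split_ifs <;> simp_all
    rw [Commute, SemiconjBy, permOp_mul, permOp_mul, hd]
  rw [Rsite_eq, Rsite_eq]
  exact (((Commute.one_left _).smul_left _).add_left
    ((((Commute.one_right _).smul_right _).add_right (h.smul_right _)).smul_left _))

theorem Rsite_yangBaxter (η : ℂ) (ξ : Fin N → ℂ) {a b c : Fin N}
    (hab : a ≠ b) (hac : a ≠ c) (hbc : b ≠ c) :
    Rsite η ξ a b * (Rsite η ξ a c * Rsite η ξ b c) =
      Rsite η ξ b c * Rsite η ξ a c * Rsite η ξ a b := by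
  have swap_mul {x y z : Fin N} (hxz : x ≠ z) (hyz : y ≠ z) :
      permOp (Equiv.swap x y) * permOp (Equiv.swap x z) =
        permOp (Equiv.swap y z) * permOp (Equiv.swap x y) := by
    rw [permOp_mul, permOp_mul]
    congr 1
    ext w
    simp only [Equiv.Perm.coe_mul, Function.comp_apply, Equiv.swap_apply_def]
    split_ifs <;> simp_all
  have h₁ := swap_mul hac hbc
  have h₂ := swap_mul hbc hac
  have h₃ := swap_mul hab hbc.symm
  have h₄ := swap_mul hbc.symm hab
  rw [Equiv.swap_comm b a] at h₂
  rw [Equiv.swap_comm c b] at h₃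
  rw [Equiv.swap_comm c a, Equiv.swap_comm c b] at h₄
  rw [Rsite_eq, Rsite_eq, Rsite_eq]
  set A := permOp (Equiv.swap a b)
  set B := permOp (Equiv.swap a c)
  set C := permOp (Equiv.swap b c)
  have h₅ : C * (B * A) = A * (B * C) := by
    rw [← h₂, ← mul_assoc, ← h₁, mul_assoc]
  simp only [add_mul, mul_add, smul_mul_assoc, mul_smul_comm, one_mul, mul_one, mul_assoc,
    smul_add, smul_smul, h₅]
  rw [← h₃, ← h₂, h₄, ← h₁]
  module

theorem Rstring_append (η : ℂ) (ξ : Fin N → ℂ) (a : Fin N) (l l' : List (Fin N)) :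
    Rstring η ξ a (l ++ l') = Rstring η ξ a l' * Rstring η ξ a l := by
  simp [Rstring]

theorem Rstring_cons (η : ℂ) (ξ : Fin N → ℂ) (a b : Fin N) (l : List (Fin N)) :
    Rstring η ξ a (b :: l) = Rstring η ξ a l * Rsite η ξ a b := by
  simp [Rstring]

theorem commute_Rstring (η : ℂ) (ξ : Fin N → ℂ) (a : Fin N) (l : List (Fin N)) (X : Op N)
    (h : ∀ b ∈ l, Commute X (Rsite η ξ a b)) : Commute X (Rstring η ξ a l) := by
  refine Commute.list_prod_right _ _ fun Y hY => ?_
  simp only [List.mem_map, List.mem_reverse] at hY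
  obtain ⟨b, hb, rfl⟩ := hY
  exact h b hb

theorem Rstring_commute (η : ℂ) (ξ : Fin N → ℂ) {a b : Fin N} (hab : a ≠ b)
    (l m : List (Fin N)) (hbl : b ∉ l) (ham : a ∉ m) (hlm : l.Disjoint m) :
    Commute (Rstring η ξ a l) (Rstring η ξ b m) := by
  refine commute_Rstring η ξ b m _ fun y hy => (commute_Rstring η ξ a l _ fun x hx => ?_).symm
  refine Rsite_commute η ξ hab.symm ?_ ?_ ?_
  · rintro rfl; exact hbl hx
  · rintro rfl; exact ham hy
  · rintro rfl; exact hlm hx hy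

/-- The Yang-Baxter equation for strings over a common list of sites. -/
theorem Rstring_yangBaxter (η : ℂ) (ξ : Fin N → ℂ) {a b : Fin N} (hab : a ≠ b)
    (l : List (Fin N)) (hl : l.Nodup) (hal : a ∉ l) (hbl : b ∉ l) :
    Rsite η ξ a b * (Rstring η ξ a l * Rstring η ξ b l) =
      Rstring η ξ b l * Rstring η ξ a l * Rsite η ξ a b := by
  induction l with
  | nil => simp [Rstring]
  | cons c l ih =>
    simp only [List.mem_cons, not_or] at hal hbl
    obtain ⟨hcl, hl⟩ := List.nodup_cons.1 hl
    have h₁ : Commute (Rsite η ξ a c) (Rstring η ξ b l) :=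
      commute_Rstring η ξ b l _ fun y hy => Rsite_commute η ξ hab
        (by rintro rfl; exact hal.2 hy) (Ne.symm hbl.1) (by rintro rfl; exact hcl hy)
    have h₂ : Commute (Rsite η ξ b c) (Rstring η ξ a l) :=
      commute_Rstring η ξ a l _ fun y hy => Rsite_commute η ξ hab.symm
        (by rintro rfl; exact hbl.2 hy) (Ne.symm hal.1) (by rintro rfl; exact hcl hy)
    have h₃ := Rsite_yangBaxter η ξ hab hal.1 hbl.1
    simp only [Rstring_cons]
    calc Rsite η ξ a b * (Rstring η ξ a l * Rsite η ξ a c * (Rstring η ξ b l * Rsite η ξ b c))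
        = Rsite η ξ a b * (Rstring η ξ a l * (Rsite η ξ a c * Rstring η ξ b l) *
            Rsite η ξ b c) := by simp only [mul_assoc]
      _ = Rsite η ξ a b * (Rstring η ξ a l * Rstring η ξ b l) *
            (Rsite η ξ a c * Rsite η ξ b c) := by rw [h₁.eq]; simp only [mul_assoc]
      _ = Rstring η ξ b l * Rstring η ξ a l *
            (Rsite η ξ a b * (Rsite η ξ a c * Rsite η ξ b c)) := by
          rw [ih hl hal.2 hbl.2]; simp only [mul_assoc]
      _ = Rstring η ξ b l * (Rstring η ξ a l * Rsite η ξ b c) *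
            (Rsite η ξ a c * Rsite η ξ a b) := by rw [h₃]; simp only [mul_assoc]
      _ = _ := by rw [← h₂.eq]; simp only [mul_assoc]

theorem eq_of_pairwise_lt_of_mem_iff {l m : List (Fin N)} (hl : l.Pairwise (· < ·))
    (hm : m.Pairwise (· < ·)) (h : ∀ x, x ∈ l ↔ x ∈ m) : l = m := by
  have hp : l.Perm m := (List.perm_ext_iff_of_nodup hl.nodup hm.nodup).2 h
  exact hp.eq_of_pairwise (fun a b _ _ hab hba => absurd hab hba.asymm) hl hm

theorem pairwise_lt_filter_finRange (P : Fin N → Bool) :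
    ((List.finRange N).filter P).Pairwise (· < ·) :=
  (List.pairwise_lt_finRange N).filter _

/-- exchange relation for strings of R-matrices.  Here `p = a_{l−1}`,
`q = a_{k+1}` and `S = {a_l,…,a_k}` is a set of sites strictly between `p` and `q`. -/
theorem statement_14 (N : ℕ) (η : ℂ) (ξ : Fin N → ℂ)
    (p q : Fin N) (hpq : p < q) (S : Finset (Fin N)) (hS : ∀ s ∈ S, p < s ∧ s < q) :
    Rstring η ξ p ((List.finRange N).filter fun b => decide (p < b) && decide (b ∉ S)) *
      Rstring η ξ q ((List.finRange N).filter fun b => decide (b < q) && decide (b ∉ S)) =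
    (η ^ 2 - (ξ q - ξ p) ^ 2) •
      (Rstring η ξ q
          ((List.finRange N).filter fun b =>
            decide (b < q) && decide (b ∉ S) && decide (b ≠ p)) *
        Rstring η ξ p
          ((List.finRange N).filter fun b =>
            decide (p < b) && decide (b ∉ S) && decide (b ≠ q))) := by
  set lo := (List.finRange N).filter fun b => decide (b < p) with hlo
  set mid := (List.finRange N).filter fun b =>
    decide (p < b) && decide (b < q) && decide (b ∉ S) with hmid
  set hi := (List.finRange N).filter fun b => decide (q < b) with hhi
  have memlo (x) : x ∈ lo ↔ x < p := by simp [hlo]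
  have memmid (x) : x ∈ mid ↔ p < x ∧ x < q ∧ x ∉ S := by simp [hmid, and_assoc]
  have memhi (x) : x ∈ hi ↔ q < x := by simp [hhi]
  have slo : lo.Pairwise (· < ·) := pairwise_lt_filter_finRange _
  have smid : mid.Pairwise (· < ·) := pairwise_lt_filter_finRange _
  have shi : hi.Pairwise (· < ·) := pairwise_lt_filter_finRange _
  clear_value lo mid hi
  clear hlo hmid hhi
  have e₁ : ((List.finRange N).filter fun b => decide (p < b) && decide (b ∉ S)) =
      mid ++ q :: hi := by
    refine eq_of_pairwise_lt_of_mem_iff (pairwise_lt_filter_finRange _) ?_ ?_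
    · simp only [List.pairwise_append, List.pairwise_cons, List.mem_cons]
      grind
    · simp only [List.mem_append, List.mem_cons, List.mem_filter, List.mem_finRange,
        memmid, memhi]
      grind
  have e₂ : ((List.finRange N).filter fun b => decide (b < q) && decide (b ∉ S)) =
      lo ++ p :: mid := by
    refine eq_of_pairwise_lt_of_mem_iff (pairwise_lt_filter_finRange _) ?_ ?_
    · simp only [List.pairwise_append, List.pairwise_cons, List.mem_cons]
      grind
    · simp only [List.mem_append, List.mem_cons, List.mem_filter, List.mem_finRange,
        memlo, memmid]
      grind
  have e₃ : ((List.finRange N).filter fun b =>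
      decide (b < q) && decide (b ∉ S) && decide (b ≠ p)) = lo ++ mid := by
    refine eq_of_pairwise_lt_of_mem_iff (pairwise_lt_filter_finRange _) ?_ ?_
    · simp only [List.pairwise_append]
      grind
    · simp only [List.mem_append, List.mem_filter, List.mem_finRange,
        memlo, memmid]
      grind
  have e₄ : ((List.finRange N).filter fun b =>
      decide (p < b) && decide (b ∉ S) && decide (b ≠ q)) = mid ++ hi := by
    refine eq_of_pairwise_lt_of_mem_iff (pairwise_lt_filter_finRange _) ?_ ?_
    · simp only [List.pairwise_append]
      grind
    · simp only [List.mem_append, List.mem_filter, List.mem_finRange,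
        memmid, memhi]
      grind
  have hpm : p ∉ mid := by simp [memmid]
  have hqm : q ∉ mid := by simp [memmid]
  have hpl : p ∉ lo := by simp [memlo]
  have hql : q ∉ lo := by simpa [memlo] using hpq.le
  have hqh : q ∉ hi := by simp [memhi]
  have c₁ : Commute (Rstring η ξ p hi) (Rstring η ξ q mid) :=
    Rstring_commute η ξ hpq.ne _ _ hqh hpm fun x hx hx' => by grind
  have c₂ : Commute (Rstring η ξ p (mid ++ hi)) (Rstring η ξ q lo) :=
    Rstring_commute η ξ hpq.ne _ _ (by simp [hqm, hqh]) hpl fun x hx hx' => by grind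
  have yb := Rstring_yangBaxter η ξ hpq.ne mid smid.nodup hpm hqm
  rw [e₁, e₂, e₃, e₄, Rstring_append, Rstring_append η ξ q lo, Rstring_append η ξ q lo,
    Rstring_cons, Rstring_cons]
  rw [Rstring_append] at c₂ ⊢
  calc Rstring η ξ p hi * Rsite η ξ p q * Rstring η ξ p mid *
        (Rstring η ξ q mid * Rsite η ξ q p * Rstring η ξ q lo)
      = Rstring η ξ p hi * (Rsite η ξ p q * (Rstring η ξ p mid * Rstring η ξ q mid)) *
          (Rsite η ξ q p * Rstring η ξ q lo) := by simp only [mul_assoc]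
    _ = Rstring η ξ p hi * Rstring η ξ q mid * Rstring η ξ p mid *
          (Rsite η ξ p q * Rsite η ξ q p) * Rstring η ξ q lo := by
        rw [yb]; simp only [mul_assoc]
    _ = (η ^ 2 - (ξ q - ξ p) ^ 2) • (Rstring η ξ q mid *
          (Rstring η ξ p hi * Rstring η ξ p mid * Rstring η ξ q lo)) := by
        rw [Rsite_unitarity, c₁.eq]
        simp only [mul_smul_comm, smul_mul_assoc, mul_one, mul_assoc]
    _ = _ := by rw [c₂.eq]; simp only [mul_assoc]

end
end SoV
end
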